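/- Under the standing hypotheses on H, let u : [t₀,∞) × 𝕋 → ℝ be a viscosity solution of ∂_t u + H(t,x,c+∂_x u) = 0. Then there exist curves x(s) : [t₀,∞) → 𝕋 calibrated by u, and every curve calibrated by u on [t₀,∞) has rotation number lim_{t→∞} (1/t) ∫_{t₀}^t ẋ(s) ds = α'(c), the derivative at c of Mather's alpha function. -/

import Mathlib

open MeasureTheory Filter Set Topology

noncomputable section

/-- The Hamiltonian vector field `X(t,x,p) = (∂_p H, -∂_x H)` on `𝕋 × ℝ` (lifted to `ℝ × ℝ`). -/
def HamVF (H : ℝ → ℝ → ℝ → ℝ) (t : ℝ) (z : ℝ × ℝ) : ℝ × ℝ :=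
  (deriv (fun p => H t z.1 p) z.2, - deriv (fun x => H t x z.2) z.1)

/-- The standing hypotheses on the Hamiltonian `H`, with the circle `𝕋 = ℝ/ℤ` modelled by
`1`-periodicity in the space variable `x`. -/
structure BurgersHyp (H : ℝ → ℝ → ℝ → ℝ) : Prop where
  smooth : ContDiff ℝ 2 (fun q : ℝ × ℝ × ℝ => H q.1 q.2.1 q.2.2)
  per_t : ∀ t x p, H (t + 1) x p = H t x p
  per_x : ∀ t x p, H t (x + 1) p = H t x p
  convexp : ∀ t x p, 0 < iteratedDeriv 2 (fun q => H t x q) p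
  superlinear : ∀ t x, Tendsto (fun p => H t x p / |p|) (Bornology.cobounded ℝ) atTop
  complete : ∀ t₀ : ℝ, ∀ z₀ : ℝ × ℝ,
    ∃ γ : ℝ → ℝ × ℝ, γ t₀ = z₀ ∧ ∀ t, HasDerivAt γ (HamVF H t (γ t)) t

/-- The Lagrangian associated to `H` by Legendre duality. -/
def Lag (H : ℝ → ℝ → ℝ → ℝ) (t x v : ℝ) : ℝ := sSup (range fun p => p * v - H t x p)

/-- `ξ` is absolutely continuous on `[a,b]` with (a.e.) derivative `g`. -/
def IsAC (ξ g : ℝ → ℝ) (a b : ℝ) : Prop :=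
  IntervalIntegrable g volume a b ∧ ∀ t ∈ Icc a b, ξ t = ξ a + ∫ s in a..t, g s

/-- The set of values over which the Hopf–Lax–Oleinik infimum is taken. -/
def hloSet (H : ℝ → ℝ → ℝ → ℝ) (c a b : ℝ) (u : ℝ → ℝ) (x : ℝ) : Set ℝ :=
  {v | ∃ ξ g : ℝ → ℝ, IsAC ξ g a b ∧ ξ b = x ∧
    IntervalIntegrable (fun s => Lag H s (ξ s) (g s) - c * g s) volume a b ∧
    v = u (ξ a) + ∫ s in a..b, (Lag H s (ξ s) (g s) - c * g s)}

/-- The Hopf–Lax–Oleinik operator `V^c_{a,b}`. -/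
def hlo (H : ℝ → ℝ → ℝ → ℝ) (c a b : ℝ) (u : ℝ → ℝ) (x : ℝ) : ℝ := sInf (hloSet H c a b u x)

/-- Viscosity subsolution of `∂_t u + H(t,x,c+∂_x u) = a` on `D`. -/
def ViscSubSol (H : ℝ → ℝ → ℝ → ℝ) (c a : ℝ) (D : Set (ℝ × ℝ)) (u : ℝ → ℝ → ℝ) : Prop :=
  ∀ φ : ℝ × ℝ → ℝ, ContDiff ℝ 1 φ → ∀ z ∈ D,
    IsLocalMax (fun w : ℝ × ℝ => u w.1 w.2 - φ w) z →
    fderiv ℝ φ z (1, 0) + H z.1 z.2 (c + fderiv ℝ φ z (0, 1)) ≤ a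

/-- Viscosity supersolution of `∂_t u + H(t,x,c+∂_x u) = a` on `D`. -/
def ViscSuperSol (H : ℝ → ℝ → ℝ → ℝ) (c a : ℝ) (D : Set (ℝ × ℝ)) (u : ℝ → ℝ → ℝ) : Prop :=
  ∀ φ : ℝ × ℝ → ℝ, ContDiff ℝ 1 φ → ∀ z ∈ D,
    IsLocalMin (fun w : ℝ × ℝ => u w.1 w.2 - φ w) z →
    a ≤ fderiv ℝ φ z (1, 0) + H z.1 z.2 (c + fderiv ℝ φ z (0, 1))

/-- Viscosity solution (Crandall–Lions) of `∂_t u + H(t,x,c+∂_x u) = a` on `D`. -/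
def ViscSol (H : ℝ → ℝ → ℝ → ℝ) (c a : ℝ) (D : Set (ℝ × ℝ)) (u : ℝ → ℝ → ℝ) : Prop :=
  ViscSubSol H c a D u ∧ ViscSuperSol H c a D u

/-- Viscosity solution of `(HJc)` on `[t₀,∞) × 𝕋`: continuous up to `t₀`, `1`-periodic in `x`,
and a viscosity solution for `t > t₀`. -/
def IsViscSolOn (H : ℝ → ℝ → ℝ → ℝ) (c t₀ : ℝ) (u : ℝ → ℝ → ℝ) : Prop :=
  ContinuousOn (fun z : ℝ × ℝ => u z.1 z.2) (Ici t₀ ×ˢ univ) ∧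
  (∀ t x, u t (x + 1) = u t x) ∧
  ViscSol H c 0 (Ioi t₀ ×ˢ univ) u

/-- `w` is `K`-semi-concave: `∂_xx w ≤ K` in the sense of distributions. -/
def SemiConcaveK (w : ℝ → ℝ) (K : ℝ) : Prop :=
  ConcaveOn ℝ univ (fun x => w x - K * x ^ 2 / 2)

/-- The class `ℰ`: functions that are (locally) the sum of a continuous and a
nonincreasing function. -/
def EClass (f : ℝ → ℝ) : Prop :=
  ∃ g h : ℝ → ℝ, Continuous g ∧ Antitone h ∧ ∀ x, f x = g x + h x

/-- Right limit `f⁻(x)`. -/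
def rlim (f : ℝ → ℝ) (q : ℝ) : ℝ := limUnder (nhdsWithin q (Ioi q)) f

/-- Left limit `f⁺(x)`. -/
def llim (f : ℝ → ℝ) (q : ℝ) : ℝ := limUnder (nhdsWithin q (Iio q)) f

def Gminus (f : ℝ → ℝ) : Set (ℝ × ℝ) := {z | z.2 = rlim f z.1}
def Gplus (f : ℝ → ℝ) : Set (ℝ × ℝ) := {z | z.2 = llim f z.1}

/-- The graph `G(f) = G⁻(f) ∩ G⁺(f)`. -/
def Ggraph (f : ℝ → ℝ) : Set (ℝ × ℝ) := Gminus f ∩ Gplus f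

/-- The closure of the graph, `G⁻(f) ∪ G⁺(f)`. -/
def Gbar (f : ℝ → ℝ) : Set (ℝ × ℝ) := Gminus f ∪ Gplus f

/-- The Jordan curve `H(f) = ⋃_x {x} × [f⁻(x), f⁺(x)]` (one period). -/
def Hset (f : ℝ → ℝ) : Set (ℝ × ℝ) :=
  {z | z.1 ∈ Icc (0:ℝ) 1 ∧ z.2 ∈ Icc (rlim f z.1) (llim f z.1)}

/-- Entropy solution of `∂_t y + ∂_x (H(t,x,y)) = 0` on `[t₀,∞) × 𝕋` (with its own
initial trace at `t₀`): distributional solution satisfying the Oleinik inequalities. -/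
def IsEntropySolOn (H : ℝ → ℝ → ℝ → ℝ) (t₀ : ℝ) (y : ℝ → ℝ → ℝ) : Prop :=
  (∀ t x, t₀ ≤ t → y t (x + 1) = y t x) ∧
  (∀ T, t₀ < T →
    IntegrableOn (fun z : ℝ × ℝ => y z.1 z.2) (Icc t₀ T ×ˢ Icc (0:ℝ) 1) volume ∧
    IntegrableOn (fun z : ℝ × ℝ => H z.1 z.2 (y z.1 z.2)) (Icc t₀ T ×ˢ Icc (0:ℝ) 1) volume) ∧
  (∀ φ : ℝ × ℝ → ℝ, ContDiff ℝ 2 φ → (∀ t x, φ (t, x + 1) = φ (t, x)) →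
    (∃ T, ∀ t x, T ≤ t → φ (t, x) = 0) →
    (∫ z in Ioi t₀ ×ˢ Ioc (0:ℝ) 1,
      (y z.1 z.2 * fderiv ℝ φ z (1, 0) + H z.1 z.2 (y z.1 z.2) * fderiv ℝ φ z (0, 1)))
      + ∫ x in (0:ℝ)..1, y t₀ x * φ (t₀, x) = 0) ∧
  (∃ K : ℝ → ℝ, (∀ t, t₀ < t → 0 < K t) ∧ AntitoneOn K (Ioi t₀) ∧
    ∀ t, t₀ < t → ∀ x δ, 0 < δ → y t (x + δ) - y t x ≤ K t * δ)

/-- `ξ` (with a.e. derivative `g`) is calibrated by `u` on `[a,b]`. -/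
def CalibratedCurve (H : ℝ → ℝ → ℝ → ℝ) (c : ℝ) (u : ℝ → ℝ → ℝ)
    (ξ g : ℝ → ℝ) (a b : ℝ) : Prop :=
  IsAC ξ g a b ∧
  IntervalIntegrable (fun s => Lag H s (ξ s) (g s) - c * g s) volume a b ∧
  u b (ξ b) = u a (ξ a) + ∫ s in a..b, (Lag H s (ξ s) (g s) - c * g s)

/-- `φ t₀ t` is the (lifted) flow of the Hamiltonian vector field of `H` between times
`t₀` and `t`. -/
def IsHamFlow (H : ℝ → ℝ → ℝ → ℝ) (φ : ℝ → ℝ → ℝ × ℝ → ℝ × ℝ) : Prop :=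
  (∀ t₀ z, φ t₀ t₀ z = z) ∧
  (∀ t₀ z t, HasDerivAt (fun s => φ t₀ s z) (HamVF H t (φ t₀ t z)) t) ∧
  (∀ t₀ t, Function.Bijective (φ t₀ t)) ∧
  (∀ t₀ t z, φ t₀ t (z + ((1:ℝ), (0:ℝ))) = φ t₀ t z + ((1:ℝ), (0:ℝ)))

/-- Periodic, measurable, integrable over a period: a representative of an element of
`L¹(𝕋)`. -/
def PerInt (y : ℝ → ℝ) : Prop :=
  (∀ x, y (x + 1) = y x) ∧ Measurable y ∧ IntervalIntegrable y volume 0 1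

/-- `E` is the time-one entropy evolution operator of `H` (extended to `L¹(𝕋)` by
`L¹`-continuity; it is considered up to a.e. equality, and satisfies the Oleinik bound). -/
structure IsEntropyOp (H : ℝ → ℝ → ℝ → ℝ) (E : (ℝ → ℝ) → (ℝ → ℝ)) : Prop where
  sol : ∀ y₀ : ℝ → ℝ, PerInt y₀ → (∃ M, ∀ x, |y₀ x| ≤ M) →
    ∃ y : ℝ → ℝ → ℝ, IsEntropySolOn H 0 y ∧ (∀ x, y 0 x = y₀ x) ∧ (∀ x, E y₀ x = y 1 x)
  maps : ∀ y, PerInt y → PerInt (E y)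
  oleinik : ∀ y, PerInt y → ∃ K, 0 < K ∧ ∀ x δ, 0 < δ → E y (x + δ) - E y x ≤ K * δ
  cont : ∀ y : ℝ → ℝ, PerInt y → ∀ z : ℕ → ℝ → ℝ, (∀ n, PerInt (z n)) →
    Tendsto (fun n => ∫ x in (0:ℝ)..1, |z n x - y x|) atTop (𝓝 0) →
    Tendsto (fun n => ∫ x in (0:ℝ)..1, |E (z n) x - E y x|) atTop (𝓝 0)

/-- Mather's alpha function: `C¹`, convex, superlinear, and every viscosity solution `u`
of `(HJc)` has `u + tα(c)` bounded. -/
def MatherAlpha (H : ℝ → ℝ → ℝ → ℝ) (α : ℝ → ℝ) : Prop :=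
  ContDiff ℝ 1 α ∧ ConvexOn ℝ univ α ∧
  Tendsto (fun c => α c / |c|) (Bornology.cobounded ℝ) atTop ∧
  ∀ c t₀ : ℝ, ∀ u : ℝ → ℝ → ℝ, IsViscSolOn H c t₀ u →
    ∃ M, ∀ t ∈ Ici t₀, ∀ x, |u t x + t * α c| ≤ M

end

/-! ### Periodic functions of class `C¹` are Lipschitz on strips -/

/-- `F` is bounded by `C` and `C`-Lipschitz on the strip `t ∈ [a,b]`, `|p| ≤ R`. -/
def LipOnStrip (F : ℝ → ℝ → ℝ → ℝ) (a b R C : ℝ) : Prop :=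
  (∀ t ∈ Icc a b, ∀ x p, |p| ≤ R → |F t x p| ≤ C) ∧
  ∀ t ∈ Icc a b, ∀ t' ∈ Icc a b, ∀ x x' p p', |p| ≤ R → |p'| ≤ R →
    |F t x p - F t' x' p'| ≤ C * (|t - t'| + |x - x'| + |p - p'|)

theorem LipOnStrip.nonneg {F : ℝ → ℝ → ℝ → ℝ} {a b R C : ℝ} (h : LipOnStrip F a b R C)
    (hab : a ≤ b) (hR : 0 ≤ R) : 0 ≤ C :=
  (abs_nonneg _).trans (h.1 a ⟨le_rfl, hab⟩ 0 0 (by simpa using hR))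

theorem add_intCast_of_periodic {F : ℝ → ℝ → ℝ → ℝ} (hper : ∀ t x p, F t (x + 1) p = F t x p)
    (t x p : ℝ) (n : ℤ) : F t (x + n) p = F t x p := by
  have h : Function.Periodic (fun x => F t x p) 1 := fun x => hper t x p
  simpa using h.int_mul n x

theorem exists_lipOnStrip {F : ℝ → ℝ → ℝ → ℝ}
    (hF : ContDiff ℝ 1 (fun q : ℝ × ℝ × ℝ => F q.1 q.2.1 q.2.2))
    (hper : ∀ t x p, F t (x + 1) p = F t x p) (a b R : ℝ) : ∃ C, LipOnStrip F a b R C := by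
  set K : Set (ℝ × ℝ × ℝ) := Icc a b ×ˢ Icc (-1) 2 ×ˢ Icc (-R) R with hK
  have hKc : IsCompact K := isCompact_Icc.prod (isCompact_Icc.prod isCompact_Icc)
  obtain ⟨L, hL⟩ :=
    (hF.locallyLipschitz.locallyLipschitzOn (s := K)).exists_lipschitzOnWith_of_compact hKc
  obtain ⟨M, hM⟩ := hKc.exists_bound_of_continuousOn hF.continuous.continuousOn
  have hbd : ∀ t ∈ Icc a b, ∀ x p, |p| ≤ R → |F t x p| ≤ M := by
    intro t ht x p hp
    have := add_intCast_of_periodic hper t (Int.fract x) p ⌊x⌋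
    rw [Int.fract_add_floor] at this
    rw [this]
    exact hM (t, Int.fract x, p) ⟨ht, ⟨by linarith [Int.fract_nonneg x],
      by linarith [Int.fract_lt_one x]⟩, abs_le.1 hp⟩
  refine ⟨max M L + 2 * max M L, fun t ht x p hp => ?_, ?_⟩
  · have := hbd t ht x p hp
    have h0 := abs_nonneg (F t x p)
    have := le_max_left M L
    linarith
  · intro t ht t' ht' x x' p p' hp hp'
    have hL0 : (0:ℝ) ≤ L := L.2
    have hmax : 0 ≤ max M L := hL0.trans (le_max_right _ _)
    by_cases hx : |x - x'| ≤ 1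
    · have e1 := add_intCast_of_periodic hper t (Int.fract x) p ⌊x⌋
      rw [Int.fract_add_floor] at e1
      have e2 := add_intCast_of_periodic hper t' (x' - ⌊x⌋) p' ⌊x⌋
      rw [sub_add_cancel] at e2
      rw [e1, e2]
      have hfr : Int.fract x = x - ⌊x⌋ := rfl
      have h0 := Int.fract_nonneg x
      have h1 := Int.fract_lt_one x
      have hx' := abs_le.1 hx
      have := hL.dist_le_mul (t, Int.fract x, p) ⟨ht, ⟨by linarith, by linarith⟩, abs_le.1 hp⟩
        (t', x' - ⌊x⌋, p') ⟨ht', ⟨by simp only; linarith, by simp only; linarith⟩, abs_le.1 hp'⟩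
      rw [Real.dist_eq] at this
      refine this.trans ?_
      have hd : dist ((t, Int.fract x, p) : ℝ × ℝ × ℝ) (t', x' - ⌊x⌋, p')
          ≤ |t - t'| + |x - x'| + |p - p'| := by
        have : Int.fract x - (x' - ⌊x⌋) = x - x' := by rw [hfr]; ring
        rw [Prod.dist_eq, Prod.dist_eq, Real.dist_eq, Real.dist_eq, Real.dist_eq, this]
        have h1 := abs_nonneg (t - t')
        have h2 := abs_nonneg (x - x')
        have h3 := abs_nonneg (p - p')
        refine max_le (by linarith) (max_le (by linarith) (by linarith))
      have h2 := le_max_right M L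
      gcongr
      linarith
    · push Not at hx
      have h1 := hbd t ht x p hp
      have h2 := hbd t' ht' x' p' hp'
      have h3 := le_max_left M L
      calc |F t x p - F t' x' p'| ≤ |F t x p| + |F t' x' p'| := abs_sub _ _
        _ ≤ (max M L + 2 * max M L) * 1 := by linarith
        _ ≤ _ := by
          gcongr
          linarith [abs_nonneg (t - t'), abs_nonneg (p - p')]

/-! ### Partial derivatives of the Hamiltonian -/

/-- The partial derivative `∂_p H`. -/
noncomputable def pDeriv (H : ℝ → ℝ → ℝ → ℝ) (t x p : ℝ) : ℝ := deriv (fun q => H t x q) p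

/-- The partial derivative `∂_x H`. -/
noncomputable def xDeriv (H : ℝ → ℝ → ℝ → ℝ) (t x p : ℝ) : ℝ := deriv (fun y => H t y p) x

/-- The Lagrangian in terms of momentum: `p ∂_p H - H`. -/
noncomputable def momLag (H : ℝ → ℝ → ℝ → ℝ) (t x p : ℝ) : ℝ := p * pDeriv H t x p - H t x p

theorem HamVF_eq (H : ℝ → ℝ → ℝ → ℝ) (t : ℝ) (z : ℝ × ℝ) :
    HamVF H t z = (pDeriv H t z.1 z.2, - xDeriv H t z.1 z.2) := rfl

namespace BurgersHyp

variable {H : ℝ → ℝ → ℝ → ℝ}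

theorem hasDerivAt_p (hH : BurgersHyp H) (t x p : ℝ) :
    HasDerivAt (fun q => H t x q) (pDeriv H t x p) p := by
  have h : Differentiable ℝ (fun q : ℝ => H t x q) :=
    (hH.smooth.comp
      (by fun_prop : ContDiff ℝ 2 (fun q : ℝ => ((t, x, q) : ℝ × ℝ × ℝ)))).differentiable
      (by norm_num)
  exact (h p).hasDerivAt

theorem hasDerivAt_x (hH : BurgersHyp H) (t x p : ℝ) :
    HasDerivAt (fun y => H t y p) (xDeriv H t x p) x := by
  have h : Differentiable ℝ (fun y : ℝ => H t y p) :=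
    (hH.smooth.comp
      (by fun_prop : ContDiff ℝ 2 (fun y : ℝ => ((t, y, p) : ℝ × ℝ × ℝ)))).differentiable
      (by norm_num)
  exact (h x).hasDerivAt

theorem contDiff_pDeriv (hH : BurgersHyp H) :
    ContDiff ℝ 1 (fun q : ℝ × ℝ × ℝ => pDeriv H q.1 q.2.1 q.2.2) := by
  have h1 : ContDiff ℝ 1 (fun q : ℝ × ℝ × ℝ =>
      fderiv ℝ (fun q : ℝ × ℝ × ℝ => H q.1 q.2.1 q.2.2) q ((0, 0, 1) : ℝ × ℝ × ℝ)) :=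
    (hH.smooth.fderiv_right (by norm_num)).clm_apply contDiff_const
  convert h1 using 2 with q
  have h2 := (hH.smooth.differentiable (by norm_num) q).hasFDerivAt
  have h3 : HasDerivAt (fun r : ℝ => ((q.1, q.2.1, r) : ℝ × ℝ × ℝ)) (0, 0, 1) q.2.2 :=
    (hasDerivAt_const _ _).prodMk ((hasDerivAt_const _ _).prodMk (hasDerivAt_id _))
  exact (hH.hasDerivAt_p _ _ _).unique (h2.comp_hasDerivAt (f := fun r : ℝ =>
    ((q.1, q.2.1, r) : ℝ × ℝ × ℝ)) q.2.2 h3)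

theorem contDiff_xDeriv (hH : BurgersHyp H) :
    ContDiff ℝ 1 (fun q : ℝ × ℝ × ℝ => xDeriv H q.1 q.2.1 q.2.2) := by
  have h1 : ContDiff ℝ 1 (fun q : ℝ × ℝ × ℝ =>
      fderiv ℝ (fun q : ℝ × ℝ × ℝ => H q.1 q.2.1 q.2.2) q ((0, 1, 0) : ℝ × ℝ × ℝ)) :=
    (hH.smooth.fderiv_right (by norm_num)).clm_apply contDiff_const
  convert h1 using 2 with q
  have h2 := (hH.smooth.differentiable (by norm_num) q).hasFDerivAt
  have h3 : HasDerivAt (fun r : ℝ => ((q.1, r, q.2.2) : ℝ × ℝ × ℝ)) (0, 1, 0) q.2.1 :=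
    (hasDerivAt_const _ _).prodMk ((hasDerivAt_id _).prodMk (hasDerivAt_const _ _))
  exact (hH.hasDerivAt_x _ _ _).unique (h2.comp_hasDerivAt (f := fun r : ℝ =>
    ((q.1, r, q.2.2) : ℝ × ℝ × ℝ)) q.2.1 h3)

theorem contDiff_momLag (hH : BurgersHyp H) :
    ContDiff ℝ 1 (fun q : ℝ × ℝ × ℝ => momLag H q.1 q.2.1 q.2.2) :=
  ((contDiff_snd.comp contDiff_snd).mul hH.contDiff_pDeriv).sub (hH.smooth.of_le (by norm_num))

theorem pDeriv_add_one (hH : BurgersHyp H) (t x p : ℝ) :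
    pDeriv H t (x + 1) p = pDeriv H t x p := by
  simp only [pDeriv, hH.per_x]

theorem xDeriv_add_one (hH : BurgersHyp H) (t x p : ℝ) :
    xDeriv H t (x + 1) p = xDeriv H t x p := by
  have : (fun y => H t y p) = fun y => H t (y + 1) p := by
    funext y; exact (hH.per_x t y p).symm
  conv_rhs => rw [xDeriv, this, deriv_comp_add_const (fun y => H t y p) 1 x]
  rfl

theorem momLag_add_one (hH : BurgersHyp H) (t x p : ℝ) :
    momLag H t (x + 1) p = momLag H t x p := by
  simp only [momLag, hH.per_x, hH.pDeriv_add_one]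

theorem continuous_H (hH : BurgersHyp H) {X : Type*} [TopologicalSpace X] {t x p : X → ℝ}
    (ht : Continuous t) (hx : Continuous x) (hp : Continuous p) :
    Continuous fun s => H (t s) (x s) (p s) :=
  hH.smooth.continuous.comp (ht.prodMk (hx.prodMk hp))

theorem continuous_pDeriv (hH : BurgersHyp H) {X : Type*} [TopologicalSpace X] {t x p : X → ℝ}
    (ht : Continuous t) (hx : Continuous x) (hp : Continuous p) :
    Continuous fun s => pDeriv H (t s) (x s) (p s) :=
  hH.contDiff_pDeriv.continuous.comp (ht.prodMk (hx.prodMk hp))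

theorem continuous_momLag (hH : BurgersHyp H) {X : Type*} [TopologicalSpace X] {t x p : X → ℝ}
    (ht : Continuous t) (hx : Continuous x) (hp : Continuous p) :
    Continuous fun s => momLag H (t s) (x s) (p s) :=
  hH.contDiff_momLag.continuous.comp (ht.prodMk (hx.prodMk hp))

theorem strictMono_pDeriv (hH : BurgersHyp H) (t x : ℝ) : StrictMono (pDeriv H t x) := by
  refine strictMono_of_deriv_pos fun p => ?_
  have := hH.convexp t x p
  rw [iteratedDeriv_succ, iteratedDeriv_one] at this
  exact this

/-- Convexity of `H` in `p`: the graph lies above its tangents. -/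
theorem tangent_le (hH : BurgersHyp H) (t x p q : ℝ) :
    H t x p + pDeriv H t x p * (q - p) ≤ H t x q := by
  have hconv : ConvexOn ℝ univ (fun r => H t x r) := by
    refine MonotoneOn.convexOn_of_deriv convex_univ ?_ ?_ ?_
    · exact (hH.continuous_H continuous_const continuous_const continuous_id).continuousOn
    · exact fun r _ => (hH.hasDerivAt_p t x r).differentiableAt.differentiableWithinAt
    · exact ((hH.strictMono_pDeriv t x).monotone).monotoneOn _
  have hd := hH.hasDerivAt_p t x p
  rcases lt_trichotomy p q with h | h | h
  · have := hconv.le_slope_of_hasDerivAt (mem_univ p) (mem_univ q) h hd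
    rw [slope_def_field, le_div_iff₀ (by linarith)] at this
    linarith
  · subst h; simp
  · have := hconv.slope_le_of_hasDerivAt (mem_univ q) (mem_univ p) h hd
    rw [slope_def_field, div_le_iff₀ (by linarith)] at this
    linarith

/-! ### The Legendre transform -/

theorem exists_pDeriv_eq (hH : BurgersHyp H) (t x v : ℝ) : ∃ p, pDeriv H t x p = v := by
  have hlim : Tendsto (fun p => H t x p - p * v) (Bornology.cobounded ℝ) atTop := by
    refine tendsto_atTop_mono' _ ?_ tendsto_norm_cobounded_atTop
    filter_upwards [(hH.superlinear t x).eventually_ge_atTop (|v| + 1),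
      tendsto_norm_cobounded_atTop.eventually_gt_atTop 0] with p hp h0
    rw [Real.norm_eq_abs] at h0 ⊢
    rw [le_div_iff₀ h0] at hp
    have := le_abs_self (p * v)
    rw [abs_mul] at this
    linarith
  rw [Metric.cobounded_eq_cocompact] at hlim
  obtain ⟨p, hp⟩ := ((hH.continuous_H continuous_const continuous_const continuous_id).sub
    (continuous_id.mul continuous_const)).exists_forall_le (f := fun p => H t x p - p * v) hlim
  refine ⟨p, ?_⟩
  have h1 : IsLocalMin (fun p => H t x p - p * v) p := Eventually.of_forall hp
  have h2 := h1.hasDerivAt_eq_zero ((hH.hasDerivAt_p t x p).sub ((hasDerivAt_id p).mul_const v))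
  simp only [one_mul] at h2
  linarith

end BurgersHyp

/-- The momentum `p` dual to the velocity `v`: the solution of `∂_p H(t,x,p) = v`. -/
noncomputable def mom (H : ℝ → ℝ → ℝ → ℝ) (t x v : ℝ) : ℝ :=
  Classical.epsilon fun p => pDeriv H t x p = v

namespace BurgersHyp

variable {H : ℝ → ℝ → ℝ → ℝ}

theorem pDeriv_mom (hH : BurgersHyp H) (t x v : ℝ) : pDeriv H t x (mom H t x v) = v :=
  Classical.epsilon_spec (hH.exists_pDeriv_eq t x v)

theorem mom_pDeriv (hH : BurgersHyp H) (t x p : ℝ) : mom H t x (pDeriv H t x p) = p :=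
  (hH.strictMono_pDeriv t x).injective (hH.pDeriv_mom _ _ _)

theorem isGreatest_lag (hH : BurgersHyp H) (t x p : ℝ) :
    IsGreatest (range fun q => q * pDeriv H t x p - H t x q) (momLag H t x p) := by
  refine ⟨⟨p, rfl⟩, ?_⟩
  rintro _ ⟨q, rfl⟩
  have := hH.tangent_le t x p q
  simp only [momLag]
  linarith

theorem lag_pDeriv (hH : BurgersHyp H) (t x p : ℝ) :
    Lag H t x (pDeriv H t x p) = momLag H t x p :=
  (hH.isGreatest_lag t x p).csSup_eq

theorem lag_eq (hH : BurgersHyp H) (t x v : ℝ) : Lag H t x v = momLag H t x (mom H t x v) := by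
  conv_lhs => rw [← hH.pDeriv_mom t x v]
  exact hH.lag_pDeriv t x _

theorem lag_eq' (hH : BurgersHyp H) (t x v : ℝ) :
    Lag H t x v = mom H t x v * v - H t x (mom H t x v) := by
  rw [hH.lag_eq, momLag, hH.pDeriv_mom]

/-- The Fenchel inequality. -/
theorem le_lag (hH : BurgersHyp H) (t x v q : ℝ) : q * v - H t x q ≤ Lag H t x v := by
  have := (hH.isGreatest_lag t x (mom H t x v)).2 ⟨q, rfl⟩
  rwa [hH.pDeriv_mom, ← hH.lag_eq] at this

theorem le_momLag (hH : BurgersHyp H) (t x p q : ℝ) :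
    q * pDeriv H t x p - H t x q ≤ momLag H t x p :=
  (hH.isGreatest_lag t x p).2 ⟨q, rfl⟩

theorem lag_add_one (hH : BurgersHyp H) (t x v : ℝ) : Lag H t (x + 1) v = Lag H t x v := by
  simp only [Lag, hH.per_x]

theorem mom_add_one (hH : BurgersHyp H) (t x v : ℝ) : mom H t (x + 1) v = mom H t x v := by
  refine (hH.strictMono_pDeriv t x).injective ?_
  rw [hH.pDeriv_mom, ← hH.pDeriv_add_one, hH.pDeriv_mom]

theorem continuous_mom (hH : BurgersHyp H) :
    Continuous (fun q : ℝ × ℝ × ℝ => mom H q.1 q.2.1 q.2.2) := by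
  rw [continuous_iff_continuousAt]
  intro q
  rw [ContinuousAt, Metric.tendsto_nhds]
  intro ε hε
  set p := mom H q.1 q.2.1 q.2.2 with hp
  have hpv : pDeriv H q.1 q.2.1 p = q.2.2 := hH.pDeriv_mom _ _ _
  have hc : ∀ r : ℝ, Continuous fun q : ℝ × ℝ × ℝ => pDeriv H q.1 q.2.1 r - q.2.2 := fun r =>
    (hH.continuous_pDeriv (by fun_prop) (by fun_prop) continuous_const).sub (by fun_prop)
  have h1 := hH.strictMono_pDeriv q.1 q.2.1 (show p < p + ε by linarith)
  have h2 := hH.strictMono_pDeriv q.1 q.2.1 (show p - ε < p by linarith)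
  have e1 : ∀ᶠ r : ℝ × ℝ × ℝ in 𝓝 q, 0 < pDeriv H r.1 r.2.1 (p + ε) - r.2.2 :=
    (hc (p + ε)).continuousAt.eventually (lt_mem_nhds (by linarith))
  have e2 : ∀ᶠ r : ℝ × ℝ × ℝ in 𝓝 q, pDeriv H r.1 r.2.1 (p - ε) - r.2.2 < 0 :=
    (hc (p - ε)).continuousAt.eventually (gt_mem_nhds (by linarith))
  filter_upwards [e1, e2] with r hr1 hr2
  have hm := hH.pDeriv_mom r.1 r.2.1 r.2.2
  have h3 : mom H r.1 r.2.1 r.2.2 < p + ε :=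
    (hH.strictMono_pDeriv r.1 r.2.1).lt_iff_lt.1 (by linarith)
  have h4 : p - ε < mom H r.1 r.2.1 r.2.2 :=
    (hH.strictMono_pDeriv r.1 r.2.1).lt_iff_lt.1 (by linarith)
  rw [Real.dist_eq, abs_lt]
  constructor <;> linarith

theorem continuous_lag (hH : BurgersHyp H) {X : Type*} [TopologicalSpace X] {t x v : X → ℝ}
    (ht : Continuous t) (hx : Continuous x) (hv : Continuous v) :
    Continuous fun s => Lag H (t s) (x s) (v s) := by
  simp only [hH.lag_eq]
  exact hH.continuous_momLag ht hx (hH.continuous_mom.comp (ht.prodMk (hx.prodMk hv)))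

end BurgersHyp

/-- A continuous function periodic in `x` is bounded on strips. -/
theorem exists_bound_on_strip {F : ℝ → ℝ → ℝ → ℝ}
    (hF : Continuous (fun q : ℝ × ℝ × ℝ => F q.1 q.2.1 q.2.2))
    (hper : ∀ t x p, F t (x + 1) p = F t x p) (a b R : ℝ) :
    ∃ M, ∀ t ∈ Icc a b, ∀ x p, |p| ≤ R → |F t x p| ≤ M := by
  obtain ⟨M, hM⟩ := (isCompact_Icc.prod (isCompact_Icc.prod isCompact_Icc) :
    IsCompact (Icc a b ×ˢ Icc (0:ℝ) 1 ×ˢ Icc (-R) R)).exists_bound_of_continuousOn hF.continuousOn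
  refine ⟨M, fun t ht x p hp => ?_⟩
  have := add_intCast_of_periodic hper t (Int.fract x) p ⌊x⌋
  rw [Int.fract_add_floor] at this
  rw [this]
  exact hM (t, Int.fract x, p) ⟨ht, ⟨Int.fract_nonneg x, (Int.fract_lt_one x).le⟩, abs_le.1 hp⟩

namespace BurgersHyp

variable {H : ℝ → ℝ → ℝ → ℝ}

theorem exists_lag_bound (hH : BurgersHyp H) (a b R : ℝ) :
    ∃ M, ∀ t ∈ Icc a b, ∀ x v, |v| ≤ R → |Lag H t x v| ≤ M :=
  exists_bound_on_strip (hH.continuous_lag (by fun_prop) (by fun_prop) (by fun_prop))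
    hH.lag_add_one a b R

theorem exists_mom_bound (hH : BurgersHyp H) (a b R : ℝ) :
    ∃ M, ∀ t ∈ Icc a b, ∀ x v, |v| ≤ R → |mom H t x v| ≤ M :=
  exists_bound_on_strip hH.continuous_mom hH.mom_add_one a b R

/-- A linear lower bound of the Lagrangian. -/
theorem exists_le_lag (hH : BurgersHyp H) (a b N : ℝ) :
    ∃ M, ∀ t ∈ Icc a b, ∀ x v, N * |v| - M ≤ Lag H t x v := by
  obtain ⟨M, hM⟩ := exists_bound_on_strip hH.smooth.continuous hH.per_x a b |N|
  refine ⟨M, fun t ht x v => ?_⟩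
  rcases abs_cases v with ⟨h, _⟩ | ⟨h, _⟩
  · have h1 := hH.le_lag t x v N
    have h2 := (abs_le.1 (hM t ht x N le_rfl)).2
    rw [h]; linarith
  · have h1 := hH.le_lag t x v (-N)
    have h2 := (abs_le.1 (hM t ht x (-N) (by rw [abs_neg]))).2
    rw [h]; linarith

/-- The Lagrangian is Lipschitz in `x`, uniformly for bounded velocities. -/
theorem exists_lag_lipschitz (hH : BurgersHyp H) (a b R : ℝ) :
    ∃ C, 0 ≤ C ∧ ∀ t ∈ Icc a b, ∀ x x' v, |v| ≤ R → Lag H t x v ≤ Lag H t x' v + C * |x - x'| := by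
  obtain ⟨M, hM⟩ := hH.exists_mom_bound a b R
  obtain ⟨C, hC⟩ := exists_lipOnStrip (hH.smooth.of_le (by norm_num)) hH.per_x a b M
  refine ⟨|C|, abs_nonneg _, fun t ht x x' v hv => ?_⟩
  have h1 := hH.le_lag t x' v (mom H t x v)
  have h2 := hH.lag_eq' t x v
  have hm := hM t ht x v hv
  have h3 := (abs_le.1 (hC.2 t ht t ht x x' _ _ hm hm)).1
  simp only [sub_self, abs_zero, zero_add, add_zero] at h3
  have h4 : C * |x - x'| ≤ |C| * |x - x'| := by gcongr; exact le_abs_self C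
  linarith

end BurgersHyp

/-! ### Orbits of the Hamiltonian vector field -/

/-- `γ` is an orbit of the Hamiltonian vector field of `H`. -/
def IsOrbit (H : ℝ → ℝ → ℝ → ℝ) (γ : ℝ → ℝ × ℝ) : Prop :=
  ∀ t, HasDerivAt γ (HamVF H t (γ t)) t

/-- The Hamiltonian vector field is bounded by `Λ` and `Λ`-Lipschitz on the strip `t ∈ [a,b]`,
`|p| ≤ R`. -/
def VFLip (H : ℝ → ℝ → ℝ → ℝ) (a b R Λ : ℝ) : Prop :=
  0 ≤ Λ ∧ (∀ t ∈ Icc a b, ∀ z : ℝ × ℝ, |z.2| ≤ R → ‖HamVF H t z‖ ≤ Λ) ∧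
  ∀ t ∈ Icc a b, ∀ t' ∈ Icc a b, ∀ z z' : ℝ × ℝ, |z.2| ≤ R → |z'.2| ≤ R →
    ‖HamVF H t z - HamVF H t' z'‖ ≤ Λ * (|t - t'| + ‖z - z'‖)

namespace IsOrbit

variable {H : ℝ → ℝ → ℝ → ℝ} {γ : ℝ → ℝ × ℝ}

theorem hasDerivAt_fst (h : IsOrbit H γ) (t : ℝ) :
    HasDerivAt (fun s => (γ s).1) (pDeriv H t (γ t).1 (γ t).2) t :=
  (hasFDerivAt_fst (𝕜 := ℝ) (p := γ t)).comp_hasDerivAt t (h t)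

theorem continuous (h : IsOrbit H γ) : Continuous γ :=
  continuous_iff_continuousAt.2 fun t => (h t).continuousAt

theorem continuous_fst (h : IsOrbit H γ) : Continuous fun t => (γ t).1 :=
  _root_.continuous_fst.comp h.continuous

theorem continuous_snd (h : IsOrbit H γ) : Continuous fun t => (γ t).2 :=
  _root_.continuous_snd.comp h.continuous

theorem exists_bound (h : IsOrbit H γ) (a b : ℝ) : ∃ R, 0 ≤ R ∧ ∀ t ∈ Icc a b, |(γ t).2| ≤ R := by
  obtain ⟨R, hR⟩ := isCompact_Icc.exists_bound_of_continuousOn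
    (h.continuous_snd.continuousOn (s := Icc a b))
  exact ⟨max R 0, le_max_right _ _, fun t ht => (hR t ht).trans (le_max_left _ _)⟩

end IsOrbit

/-- A Gronwall estimate for curves which are only controlled near the origin. -/
theorem norm_le_exp_of_norm_deriv_le {f f' : ℝ → ℝ × ℝ} {Λ ℓ D : ℝ} (hΛ : 0 ≤ Λ) (hD : 0 < D)
    (hf : ∀ t, HasDerivAt f (f' t) t)
    (hf' : ∀ t ∈ Icc 0 ℓ, ‖f t‖ ≤ 1 → ‖f' t‖ ≤ Λ * ‖f t‖) (h0 : ‖f 0‖ ≤ D)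
    (hℓ : D * Real.exp ((Λ + 1) * ℓ) ≤ 1) : ∀ t ∈ Icc 0 ℓ, ‖f t‖ ≤ D * Real.exp ((Λ + 1) * ℓ) := by
  have key : ∀ t ∈ Icc 0 ℓ, ‖f t‖ ≤ D * Real.exp ((Λ + 1) * t) := by
    refine image_norm_le_of_norm_deriv_right_lt_deriv_boundary (f' := f')
      (B' := fun t => D * (Real.exp ((Λ + 1) * t) * (Λ + 1)))
      (fun t _ => (hf t).continuousAt.continuousWithinAt) (fun t _ => (hf t).hasDerivWithinAt)
      (by simpa using h0) (fun t => ?_) (fun t ht hft => ?_)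
    · have := (((hasDerivAt_id t).const_mul (Λ + 1)).exp).const_mul D
      simpa using this
    · have h1 : ‖f t‖ ≤ 1 := by
        rw [hft]
        refine le_trans ?_ hℓ
        have := ht.2.le
        gcongr
      have h2 := hf' t ⟨ht.1, ht.2.le⟩ h1
      rw [hft] at h2
      have : 0 < D * Real.exp ((Λ + 1) * t) := by positivity
      nlinarith
  intro t ht
  refine (key t ht).trans ?_
  have := ht.2
  gcongr

namespace BurgersHyp

variable {H : ℝ → ℝ → ℝ → ℝ}

theorem exists_orbit (hH : BurgersHyp H) (t₀ : ℝ) (z₀ : ℝ × ℝ) :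
    ∃ γ, IsOrbit H γ ∧ γ t₀ = z₀ := by
  obtain ⟨γ, h, h'⟩ := hH.complete t₀ z₀
  exact ⟨γ, h', h⟩

theorem exists_vfLip (hH : BurgersHyp H) (a b R : ℝ) : ∃ Λ, VFLip H a b R Λ := by
  obtain ⟨C, hC⟩ := exists_lipOnStrip hH.contDiff_pDeriv hH.pDeriv_add_one a b R
  obtain ⟨D, hD⟩ := exists_lipOnStrip hH.contDiff_xDeriv hH.xDeriv_add_one a b R
  set M := max |C| |D|
  have hM : 0 ≤ M := (abs_nonneg C).trans (le_max_left _ _)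
  have hCM : C ≤ M := (le_abs_self C).trans (le_max_left _ _)
  have hDM : D ≤ M := (le_abs_self D).trans (le_max_right _ _)
  refine ⟨2 * M, by positivity, fun t ht z hz => ?_, fun t ht t' ht' z z' hz hz' => ?_⟩
  · rw [HamVF_eq, Prod.norm_def]
    have h1 := hC.1 t ht z.1 z.2 hz
    have h2 := hD.1 t ht z.1 z.2 hz
    simp only [norm_neg, Real.norm_eq_abs]
    exact max_le (by linarith) (by linarith)
  · rw [HamVF_eq, HamVF_eq, Prod.norm_def]
    have h1 := hC.2 t ht t' ht' z.1 z'.1 z.2 z'.2 hz hz'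
    have h2 := hD.2 t ht t' ht' z.1 z'.1 z.2 z'.2 hz hz'
    have h3 : |z.1 - z'.1| ≤ ‖z - z'‖ := norm_fst_le (z - z')
    have h4 : |z.2 - z'.2| ≤ ‖z - z'‖ := norm_snd_le (z - z')
    have h5 := abs_nonneg (t - t')
    have h6 : |t - t'| + |z.1 - z'.1| + |z.2 - z'.2| ≤ 2 * (|t - t'| + ‖z - z'‖) := by linarith
    have h7 : 0 ≤ |t - t'| + |z.1 - z'.1| + |z.2 - z'.2| := by positivity
    have h8 : M * (|t - t'| + |z.1 - z'.1| + |z.2 - z'.2|) ≤ 2 * M * (|t - t'| + ‖z - z'‖) := by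
      nlinarith
    have h9 := mul_le_mul_of_nonneg_right hCM h7
    have h10 := mul_le_mul_of_nonneg_right hDM h7
    simp only [Prod.fst_sub, Prod.snd_sub, neg_sub_neg, Real.norm_eq_abs]
    rw [abs_sub_comm (xDeriv H t' z'.1 z'.2)]
    exact max_le (by linarith) (by linarith)

end BurgersHyp

/-- Orbits close to a given orbit at some time remain close on compact intervals. -/
theorem IsOrbit.norm_sub_le {H : ℝ → ℝ → ℝ → ℝ} {γ η : ℝ → ℝ × ℝ} (hγ : IsOrbit H γ)
    (hη : IsOrbit H η) {a b R Λ D s : ℝ} (hR : ∀ t ∈ Icc a b, |(γ t).2| ≤ R)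
    (hΛ : VFLip H a b (R + 1) Λ) (hs : s ∈ Icc a b) (hD : 0 < D) (h0 : ‖η s - γ s‖ ≤ D)
    (h1 : D * Real.exp ((Λ + 1) * (b - a)) ≤ 1) :
    ∀ t ∈ Icc a b, ‖η t - γ t‖ ≤ D * Real.exp ((Λ + 1) * (b - a)) := by
  have hΛ0 := hΛ.1
  have hd : ∀ t ∈ Icc a b, ‖η t - γ t‖ ≤ 1 →
      ‖HamVF H t (η t) - HamVF H t (γ t)‖ ≤ Λ * ‖η t - γ t‖ := by
    intro t ht h
    have h2 := hR t ht
    have h3 : |(η t).2 - (γ t).2| ≤ 1 := (norm_snd_le (η t - γ t)).trans h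
    have h4 : |(η t).2| ≤ R + 1 := by
      have := abs_add_le ((η t).2 - (γ t).2) (γ t).2
      rw [sub_add_cancel] at this
      linarith
    simpa using hΛ.2.2 t ht t ht (η t) (γ t) h4 (by linarith)
  have hmono : ∀ ℓ, ℓ ≤ b - a → D * Real.exp ((Λ + 1) * ℓ) ≤ D * Real.exp ((Λ + 1) * (b - a)) := by
    intro ℓ hℓ
    gcongr
  intro t ht
  rcases le_total s t with h | h
  · have := norm_le_exp_of_norm_deriv_le (f := fun r => η (s + r) - γ (s + r)) (ℓ := t - s) hΛ0 hD
      (fun r => ((hη (s + r)).comp_const_add s r).sub ((hγ (s + r)).comp_const_add s r))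
      (fun r hr => hd _ ⟨by linarith [hr.1, hs.1], by linarith [hr.2, ht.2]⟩) (by simpa using h0)
      ((hmono _ (by linarith [hs.1, ht.2])).trans h1) (t - s) ⟨by linarith, le_rfl⟩
    simp only [add_sub_cancel] at this
    exact this.trans (hmono _ (by linarith [hs.1, ht.2]))
  · have := norm_le_exp_of_norm_deriv_le (f := fun r => η (s - r) - γ (s - r)) (ℓ := s - t) hΛ0 hD
      (fun r => ((hη (s - r)).comp_const_sub s r).sub ((hγ (s - r)).comp_const_sub s r))
      (fun r hr h' => by
        have := hd (s - r) ⟨by linarith [hr.2, ht.1], by linarith [hr.1, hs.2]⟩ h'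
        rwa [neg_sub_neg, norm_sub_rev]) (by simpa using h0)
      ((hmono _ (by linarith [hs.2, ht.1])).trans h1) (s - t) ⟨by linarith, le_rfl⟩
    simp only [sub_sub_cancel] at this
    exact this.trans (hmono _ (by linarith [hs.2, ht.1]))

namespace IsOrbit

variable {H : ℝ → ℝ → ℝ → ℝ} {γ : ℝ → ℝ × ℝ}

theorem add_const (hH : BurgersHyp H) (hγ : IsOrbit H γ) (n : ℤ) :
    IsOrbit H (fun t => γ t + ((n : ℝ), 0)) := by
  intro t
  have e : HamVF H t (γ t + ((n : ℝ), 0)) = HamVF H t (γ t) := by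
    simp only [HamVF_eq, Prod.fst_add, Prod.snd_add, add_zero,
      add_intCast_of_periodic hH.pDeriv_add_one, add_intCast_of_periodic hH.xDeriv_add_one]
  have h := (hγ t).add_const ((n : ℝ), (0 : ℝ))
  rwa [← e] at h

/-- Continuous dependence of orbits on initial conditions. -/
theorem tendstoUniformlyOn (hH : BurgersHyp H) (hγ : IsOrbit H γ) {η : ℕ → ℝ → ℝ × ℝ}
    (hη : ∀ n, IsOrbit H (η n)) {a b s : ℝ} (hs : s ∈ Icc a b)
    (h : Tendsto (fun n => η n s) atTop (𝓝 (γ s))) : TendstoUniformlyOn η γ atTop (Icc a b) := by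
  obtain ⟨R, -, hR⟩ := hγ.exists_bound a b
  obtain ⟨Λ, hΛ⟩ := hH.exists_vfLip a b (R + 1)
  rw [Metric.tendstoUniformlyOn_iff]
  intro ε hε
  set E := Real.exp ((Λ + 1) * (b - a)) with hE
  have hE0 : 0 < E := Real.exp_pos _
  set D := min 1 (ε / 2) / E
  have hD : 0 < D := by positivity
  have hDE : D * E = min 1 (ε / 2) := div_mul_cancel₀ _ hE0.ne'
  filter_upwards [Metric.tendsto_nhds.1 h D hD] with n hn t ht
  rw [dist_eq_norm] at hn
  have := hγ.norm_sub_le (hη n) hR hΛ hs hD hn.le (by rw [hDE]; exact min_le_left _ _) t ht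
  rw [dist_comm, dist_eq_norm]
  rw [hDE] at this
  have h2 := min_le_right 1 (ε / 2)
  linarith

end IsOrbit

/-- A priori bound: the momentum of an orbit on `[a,b]` is controlled by its value at one time. -/
theorem BurgersHyp.exists_orbit_bound {H : ℝ → ℝ → ℝ → ℝ} (hH : BurgersHyp H) (a b K : ℝ) :
    ∃ K', ∀ η, IsOrbit H η → ∀ s ∈ Icc a b, |(η s).2| ≤ K → ∀ t ∈ Icc a b, |(η t).2| ≤ K' := by
  have key : ∃ K', ∀ q ∈ Icc a b ×ˢ Icc (0:ℝ) 1 ×ˢ Icc (-K) K, ∀ η, IsOrbit H η →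
      η q.1 = q.2 → ∀ t ∈ Icc a b, |(η t).2| ≤ K' := by
    refine (isCompact_Icc.prod (isCompact_Icc.prod isCompact_Icc) :
      IsCompact (Icc a b ×ˢ Icc (0:ℝ) 1 ×ˢ Icc (-K) K)).induction_on
      (p := fun S => ∃ K', ∀ q ∈ S, ∀ η, IsOrbit H η → η q.1 = q.2 → ∀ t ∈ Icc a b, |(η t).2| ≤ K')
      ⟨0, by simp⟩ (fun S T hST ⟨K', h⟩ => ⟨K', fun q hq => h q (hST hq)⟩) ?_ ?_
    · rintro S T ⟨K₁, h₁⟩ ⟨K₂, h₂⟩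
      refine ⟨max K₁ K₂, ?_⟩
      rintro q (hq | hq) η hη hηq t ht
      · exact (h₁ q hq η hη hηq t ht).trans (le_max_left _ _)
      · exact (h₂ q hq η hη hηq t ht).trans (le_max_right _ _)
    · intro q hq
      obtain ⟨γ, hγ, hγq⟩ := hH.exists_orbit q.1 q.2
      obtain ⟨R, -, hR⟩ := hγ.exists_bound a b
      obtain ⟨Λ, hΛ⟩ := hH.exists_vfLip a b (R + 1)
      set D := 1 / Real.exp ((Λ + 1) * (b - a)) with hDdef
      have hE0 : 0 < Real.exp ((Λ + 1) * (b - a)) := Real.exp_pos _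
      have hD : 0 < D := by positivity
      have hDE : D * Real.exp ((Λ + 1) * (b - a)) = 1 := div_mul_cancel₀ _ hE0.ne'
      have hcont : Continuous fun r : ℝ × ℝ × ℝ => ‖r.2 - γ r.1‖ :=
        (continuous_snd.sub (hγ.continuous.comp continuous_fst)).norm
      have hev : ∀ᶠ r : ℝ × ℝ × ℝ in 𝓝 q, ‖r.2 - γ r.1‖ < D :=
        hcont.continuousAt.eventually (gt_mem_nhds (by simpa [hγq] using hD))
      refine ⟨{r | ‖r.2 - γ r.1‖ < D} ∩ Icc a b ×ˢ univ, ?_, R + 1, ?_⟩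
      · refine inter_mem (mem_nhdsWithin_of_mem_nhds hev) ?_
        filter_upwards [self_mem_nhdsWithin] with r hr
        exact ⟨hr.1, trivial⟩
      · rintro r ⟨hr, hr1, -⟩ η hη hηr t ht
        have h1 := hγ.norm_sub_le hη hR hΛ hr1 hD (by rw [hηr]; exact le_of_lt hr) hDE.le t ht
        rw [hDE] at h1
        have h2 : |(η t).2 - (γ t).2| ≤ 1 := (norm_snd_le (η t - γ t)).trans h1
        have h3 := abs_add_le ((η t).2 - (γ t).2) (γ t).2
        rw [sub_add_cancel] at h3
        linarith [hR t ht]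
  obtain ⟨K', hK'⟩ := key
  refine ⟨K', fun η hη s hs hηs t ht => ?_⟩
  have := hK' (s, η s + (((-⌊(η s).1⌋ : ℤ) : ℝ), 0)) ⟨hs, ⟨?_, ?_⟩, ?_⟩ _
    (hη.add_const hH (-⌊(η s).1⌋)) rfl t ht
  · simpa using this
  · have := Int.floor_le (η s).1
    simp only [Prod.fst_add, Int.cast_neg]; linarith
  · have := Int.lt_floor_add_one (η s).1
    simp only [Prod.fst_add, Int.cast_neg]; linarith
  · simpa using abs_le.1 hηs

/-- Stability of the Euler scheme. -/
theorem IsOrbit.norm_euler_sub_le {H : ℝ → ℝ → ℝ → ℝ} {γ : ℝ → ℝ × ℝ} (hγ : IsOrbit H γ)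
    {a b R Λ τ e C : ℝ} (hR : ∀ t ∈ Icc a b, |(γ t).2| ≤ R) (hΛ : VFLip H a b (R + 1) Λ)
    (hτ : 0 ≤ τ) {n : ℕ} (hn : a + n * τ ≤ b) {Z : ℕ → ℝ × ℝ} (hC : 0 ≤ C)
    (hZ : ∀ k < n, |(Z k).2| ≤ R + 1 →
      ‖Z (k + 1) - Z k - τ • HamVF H (a + k * τ) (Z k)‖ ≤ C * τ ^ 2)
    (h0 : ‖Z 0 - γ a‖ ≤ e)
    (h1 : Real.exp (Λ * (b - a)) * (e + (C + Λ * (1 + Λ)) * τ * (b - a)) ≤ 1) :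
    ∀ k ≤ n, ‖Z k - γ (a + k * τ)‖ ≤
      Real.exp (Λ * (b - a)) * (e + (C + Λ * (1 + Λ)) * τ * (b - a)) := by
  have hΛ0 := hΛ.1
  have hkn : ∀ k : ℕ, k ≤ n → a + k * τ ∈ Icc a b := by
    intro k hk
    have : (k : ℝ) ≤ n := by exact_mod_cast hk
    have h2 : (k : ℝ) * τ ≤ n * τ := by gcongr
    exact ⟨by linarith [mul_nonneg (Nat.cast_nonneg' k : (0:ℝ) ≤ k) hτ], by linarith⟩
  have he : 0 ≤ e := (norm_nonneg _).trans h0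
  set C' := C + Λ * (1 + Λ) with hC'
  have hC'0 : 0 ≤ C' := by positivity
  have hgrow : ∀ k ≤ n, (1 + Λ * τ) ^ k * (e + k * (C' * τ ^ 2)) ≤
      Real.exp (Λ * (b - a)) * (e + C' * τ * (b - a)) := by
    intro k hk
    have h2 := (hkn k hk).2
    have h3 : (1 + Λ * τ) ^ k ≤ Real.exp (Λ * (b - a)) := by
      calc (1 + Λ * τ) ^ k ≤ (Real.exp (Λ * τ)) ^ k := by
            gcongr
            linarith [Real.add_one_le_exp (Λ * τ)]
        _ = Real.exp (Λ * (k * τ)) := by rw [← Real.exp_nat_mul]; congr 1; ring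
        _ ≤ _ := by gcongr; linarith
    have h4 : k * (C' * τ ^ 2) ≤ C' * τ * (b - a) := by
      calc k * (C' * τ ^ 2) = C' * τ * (k * τ) := by ring
        _ ≤ _ := by gcongr; linarith
    gcongr
  -- local truncation error of the scheme along the orbit
  have hloc : ∀ k < n, ‖γ (a + (k + 1 : ℕ) * τ) - γ (a + k * τ) -
      τ • HamVF H (a + k * τ) (γ (a + k * τ))‖ ≤ Λ * (1 + Λ) * τ ^ 2 := by
    intro k hk
    have hk1 := hkn k hk.le
    have hk2 := hkn (k + 1) hk
    set s := a + k * τ with hs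
    have hs' : a + (k + 1 : ℕ) * τ = s + τ := by rw [hs]; push_cast; ring
    rw [hs'] at hk2 ⊢
    have hsub : Icc s (s + τ) ⊆ Icc a b := Icc_subset_Icc hk1.1 hk2.2
    have hbd : ∀ r ∈ Icc s (s + τ), ‖γ r - γ s‖ ≤ Λ * τ := by
      intro r hr
      have := (convex_Icc s (s + τ)).norm_image_sub_le_of_norm_hasDerivWithin_le
        (fun r _ => (hγ r).hasDerivWithinAt)
        (fun r hr => hΛ.2.1 r (hsub hr) _ ((hR r (hsub hr)).trans (by linarith)))
        (left_mem_Icc.2 (by linarith)) hr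
      refine this.trans ?_
      rw [Real.norm_eq_abs, abs_of_nonneg (by linarith [hr.1])]
      have := hr.2
      gcongr
      linarith
    have h2 := (convex_Icc s (s + τ)).norm_image_sub_le_of_norm_hasDerivWithin_le
      (f := fun r => γ r - (r - s) • HamVF H s (γ s)) (C := Λ * (τ + Λ * τ))
      (fun r _ => ((hγ r).sub (((hasDerivAt_id r).sub_const s).smul_const
        (HamVF H s (γ s)))).hasDerivWithinAt)
      (fun r hr => by
        rw [one_smul]
        refine (hΛ.2.2 r (hsub hr) s hk1 (γ r) (γ s) ((hR r (hsub hr)).trans (by linarith))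
          ((hR s hk1).trans (by linarith))).trans ?_
        have h3 := hbd r hr
        have h4 : |r - s| ≤ τ := by
          rw [abs_of_nonneg (by linarith [hr.1])]; linarith [hr.2]
        gcongr)
      (left_mem_Icc.2 (by linarith)) (right_mem_Icc.2 (by linarith))
    simp only [add_sub_cancel_left, sub_self, zero_smul, sub_zero, Real.norm_eq_abs,
      abs_of_nonneg hτ] at h2
    rw [sub_right_comm]
    refine h2.trans (le_of_eq ?_)
    ring
  have key : ∀ k ≤ n, ‖Z k - γ (a + k * τ)‖ ≤ (1 + Λ * τ) ^ k * (e + k * (C' * τ ^ 2)) := by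
    intro k
    induction k with
    | zero => intro _; simpa using h0
    | succ k ih =>
      intro hk
      have hk' : k < n := hk
      have h2 := ih hk'.le
      have h3 := h2.trans ((hgrow k hk'.le).trans h1)
      have h4 := hR _ (hkn k hk'.le)
      have h5 : |(Z k).2| ≤ R + 1 := by
        have h6 : |(Z k).2 - (γ (a + k * τ)).2| ≤ 1 := (norm_snd_le (Z k - γ (a + k * τ))).trans h3
        have := abs_add_le ((Z k).2 - (γ (a + k * τ)).2) (γ (a + k * τ)).2
        rw [sub_add_cancel] at this
        linarith
      have h6 := hZ k hk' h5
      have h7 := hloc k hk'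
      have h8 := hΛ.2.2 _ (hkn k hk'.le) _ (hkn k hk'.le) (Z k) (γ (a + k * τ)) h5 (by linarith)
      rw [sub_self, abs_zero, zero_add] at h8
      set F := HamVF H (a + k * τ) (Z k)
      set G := HamVF H (a + k * τ) (γ (a + k * τ))
      set y := γ (a + k * τ)
      set y' := γ (a + (k + 1 : ℕ) * τ)
      have h9 : Z (k + 1) - y' = (Z (k + 1) - Z k - τ • F) - (y' - y - τ • G) + (Z k - y) +
          τ • (F - G) := by
        rw [smul_sub]; abel
      have h10 : ‖τ • (F - G)‖ ≤ τ * (Λ * ‖Z k - y‖) := by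
        rw [norm_smul, Real.norm_eq_abs, abs_of_nonneg hτ]
        gcongr
      have h11 : ‖Z (k + 1) - y'‖ ≤ (1 + Λ * τ) * ‖Z k - y‖ + C' * τ ^ 2 := by
        rw [h9]
        refine (norm_add_le _ _).trans ?_
        refine (add_le_add ((norm_add_le _ _).trans (add_le_add (_root_.norm_sub_le _ _) le_rfl))
          h10).trans
          ?_
        rw [hC']
        linarith
      have h12 : 1 ≤ (1 + Λ * τ) ^ (k + 1) := one_le_pow₀ (by linarith [mul_nonneg hΛ0 hτ])
      calc ‖Z (k + 1) - y'‖ ≤ (1 + Λ * τ) * ((1 + Λ * τ) ^ k * (e + k * (C' * τ ^ 2))) +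
            1 * (C' * τ ^ 2) := by
              rw [one_mul]
              exact h11.trans (by gcongr)
        _ ≤ (1 + Λ * τ) * ((1 + Λ * τ) ^ k * (e + k * (C' * τ ^ 2))) +
            (1 + Λ * τ) ^ (k + 1) * (C' * τ ^ 2) := by gcongr
        _ = _ := by push_cast; ring
  exact fun k hk => (key k hk).trans (hgrow k hk)

/-! ### Differentiability of the Lagrangian -/

/-- The Lagrangian is differentiable in `(x,v)`, with derivative `(-∂_x H, p)`. -/
theorem BurgersHyp.hasDerivAt_lag {H : ℝ → ℝ → ℝ → ℝ} (hH : BurgersHyp H) (t y v a b : ℝ) :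
    HasDerivAt (fun s => Lag H t (y + s * a) (v + s * b))
      (- xDeriv H t y (mom H t y v) * a + mom H t y v * b) 0 := by
  set m : ℝ → ℝ := fun s => mom H t (y + s * a) (v + s * b) with hm
  have hm0 : m 0 = mom H t y v := by simp [hm]
  have hmc : Continuous m := hH.continuous_mom.comp
    (by fun_prop : Continuous fun s : ℝ => ((t, y + s * a, v + s * b) : ℝ × ℝ × ℝ))
  rw [← hm0]
  set D := - xDeriv H t y (m 0) * a + m 0 * b with hD
  have hstrict : HasStrictFDerivAt (fun q : ℝ × ℝ × ℝ => H q.1 q.2.1 q.2.2)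
      (fderiv ℝ (fun q : ℝ × ℝ × ℝ => H q.1 q.2.1 q.2.2) (t, y, m 0)) (t, y, m 0) :=
    hH.smooth.contDiffAt.hasStrictFDerivAt (by norm_num)
  have hfd : ∀ s : ℝ, fderiv ℝ (fun q : ℝ × ℝ × ℝ => H q.1 q.2.1 q.2.2) (t, y, m 0) (0, s * a, 0)
      = s * (a * xDeriv H t y (m 0)) := by
    intro s
    have h3 : HasDerivAt (fun r : ℝ => ((t, r, m 0) : ℝ × ℝ × ℝ)) (0, 1, 0) y :=
      (hasDerivAt_const _ _).prodMk ((hasDerivAt_id _).prodMk (hasDerivAt_const _ _))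
    have h4 := (hH.hasDerivAt_x t y (m 0)).unique (hstrict.hasFDerivAt.comp_hasDerivAt
      (f := fun r : ℝ => ((t, r, m 0) : ℝ × ℝ × ℝ)) y h3)
    have h5 : ((0, s * a, 0) : ℝ × ℝ × ℝ) = (s * a) • ((0, 1, 0) : ℝ × ℝ × ℝ) := by simp
    rw [h5, map_smul, ← h4, smul_eq_mul, mul_assoc]
  have hincr : ∀ r : ℝ → ℝ, Continuous r → r 0 = m 0 →
      (fun s => H t (y + s * a) (r s) - H t y (r s) - s * (a * xDeriv H t y (m 0)))
        =o[𝓝 0] fun s : ℝ => s := by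
    intro r hr hr0
    have h1 : Tendsto (fun s : ℝ => (((t, y + s * a, r s), (t, y, r s)) :
        (ℝ × ℝ × ℝ) × (ℝ × ℝ × ℝ))) (𝓝 0) (𝓝 ((t, y, m 0), (t, y, m 0))) := by
      have : Continuous fun s : ℝ => (((t, y + s * a, r s), (t, y, r s)) :
        (ℝ × ℝ × ℝ) × (ℝ × ℝ × ℝ)) := by fun_prop
      simpa [hr0] using this.tendsto 0
    have h2 := hstrict.isLittleO.comp_tendsto h1
    have h3 : (fun s : ℝ => ((t, y + s * a, r s) : ℝ × ℝ × ℝ) - (t, y, r s)) = fun s =>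
        (0, s * a, 0) := by
      funext s; simp
    have h4 : (fun s : ℝ => ((0, s * a, 0) : ℝ × ℝ × ℝ)) =O[𝓝 0] fun s : ℝ => s := by
      refine Asymptotics.IsBigO.of_bound |a| (Eventually.of_forall fun s => ?_)
      simp [Prod.norm_def, mul_comm]
      positivity
    refine Asymptotics.IsLittleO.trans_isBigO ?_ h4
    refine (h2.congr (fun s => ?_) fun s => ?_)
    · simp only [Function.comp]
      rw [show ((t, y + s * a, r s) : ℝ × ℝ × ℝ) - (t, y, r s) = (0, s * a, 0) from congrFun h3 s,
        hfd]
    · exact congrFun h3 s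
  have hlow := hincr (fun _ => m 0) continuous_const rfl
  have hupp := hincr m hmc rfl
  have hmm : (fun s => (m s - m 0) * (b * s)) =o[𝓝 0] fun s : ℝ => s := by
    have h1 : (fun s => m s - m 0) =o[𝓝 0] fun _ : ℝ => (1 : ℝ) := by
      rw [Asymptotics.isLittleO_one_iff]
      have : Continuous fun s => m s - m 0 := hmc.sub continuous_const
      simpa using this.tendsto 0
    have h2 : (fun s : ℝ => b * s) =O[𝓝 0] fun s : ℝ => s := Asymptotics.isBigO_const_mul_self _ _ _
    simpa using h1.mul_isBigO h2
  have hL0 := hH.lag_eq' t y v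
  rw [← hm0] at hL0
  rw [hasDerivAt_iff_isLittleO]
  simp only [zero_mul, add_zero, sub_zero, smul_eq_mul]
  refine Asymptotics.IsLittleO.of_norm_left ?_
  refine Asymptotics.IsBigO.trans_isLittleO (g := fun s =>
    ‖H t (y + s * a) (m 0) - H t y (m 0) - s * (a * xDeriv H t y (m 0))‖ +
    (‖H t (y + s * a) (m s) - H t y (m s) - s * (a * xDeriv H t y (m 0))‖ +
      ‖(m s - m 0) * (b * s)‖)) ?_ (hlow.norm_left.add (hupp.norm_left.add hmm.norm_left))
  refine Asymptotics.IsBigO.of_bound 1 (Eventually.of_forall fun s => ?_)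
  rw [one_mul, norm_norm]
  refine le_trans ?_ (le_abs_self _)
  have h1 := hH.le_lag t (y + s * a) (v + s * b) (m 0)
  have h2 := hH.lag_eq' t (y + s * a) (v + s * b)
  have h3 := hH.le_lag t y v (m s)
  change Lag H t (y + s * a) (v + s * b) = m s * (v + s * b) - H t (y + s * a) (m s) at h2
  simp only [Real.norm_eq_abs]
  have e1 := neg_abs_le (H t (y + s * a) (m 0) - H t y (m 0) - s * (a * xDeriv H t y (m 0)))
  have e1' := le_abs_self (H t (y + s * a) (m 0) - H t y (m 0) - s * (a * xDeriv H t y (m 0)))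
  have e2 := neg_abs_le (H t (y + s * a) (m s) - H t y (m s) - s * (a * xDeriv H t y (m 0)))
  have e2' := le_abs_self (H t (y + s * a) (m s) - H t y (m s) - s * (a * xDeriv H t y (m 0)))
  have e3 := le_abs_self ((m s - m 0) * (b * s))
  have e3' := neg_abs_le ((m s - m 0) * (b * s))
  rw [abs_le, hD]
  constructor <;> nlinarith

/-! ### Discrete minimization -/

/-- Discretized action of the sequence `X`, with initial cost `w`. -/
noncomputable def discreteAction (H : ℝ → ℝ → ℝ → ℝ) (w : ℝ → ℝ) (a τ : ℝ) (n : ℕ)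
    (X : ℕ → ℝ) : ℝ :=
  w (X 0) + ∑ k ∈ Finset.range n, τ * Lag H (a + k * τ) (X (k + 1)) ((X (k + 1) - X k) / τ)

section

variable {H : ℝ → ℝ → ℝ → ℝ} {w : ℝ → ℝ} {a τ x M : ℝ} {n : ℕ}

theorem le_discreteAction (hτ : 0 < τ)
    (hM : ∀ k < n, ∀ x v, |v| - M ≤ Lag H (a + k * τ) x v) {X : ℕ → ℝ} {j : ℕ} (hj : j ≤ n) :
    w (X 0) + |X n - X j| - n * τ * M ≤ discreteAction H w a τ n X := by
  have h1 : ∀ k ∈ Finset.range n, |X (k + 1) - X k| - τ * M ≤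
      τ * Lag H (a + k * τ) (X (k + 1)) ((X (k + 1) - X k) / τ) := by
    intro k hk
    have := hM k (Finset.mem_range.1 hk) (X (k + 1)) ((X (k + 1) - X k) / τ)
    rw [abs_div, abs_of_pos hτ] at this
    have h2 := mul_le_mul_of_nonneg_left this hτ.le
    rw [mul_sub, mul_div_cancel₀ _ hτ.ne'] at h2
    exact h2
  have h2 := Finset.sum_le_sum h1
  rw [Finset.sum_sub_distrib, Finset.sum_const, Finset.card_range, nsmul_eq_mul] at h2
  have h3 : |X n - X j| ≤ ∑ k ∈ Finset.range n, |X (k + 1) - X k| := by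
    have h4 : X n - X j = ∑ k ∈ Finset.Ico j n, (X (k + 1) - X k) := by
      rw [Finset.sum_Ico_eq_sub _ hj, Finset.sum_range_sub, Finset.sum_range_sub]; ring
    rw [h4]
    refine (Finset.abs_sum_le_sum_abs _ _).trans (Finset.sum_le_sum_of_subset_of_nonneg ?_ ?_)
    · intro k hk; simp only [Finset.mem_Ico] at hk; exact Finset.mem_range.2 hk.2
    · intros; exact abs_nonneg _
  rw [discreteAction]
  linarith

theorem exists_discreteAction_min (hH : BurgersHyp H) (hw : Continuous w) {W : ℝ}
    (hW : ∀ y, |w y| ≤ W) (hτ : 0 < τ) (hM : ∀ k < n, ∀ x v, |v| - M ≤ Lag H (a + k * τ) x v)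
    (x : ℝ) : ∃ X : ℕ → ℝ, X n = x ∧
      ∀ Y : ℕ → ℝ, Y n = x → discreteAction H w a τ n X ≤ discreteAction H w a τ n Y := by
  let ext : (Fin n → ℝ) → ℕ → ℝ := fun y k => if h : k < n then y ⟨k, h⟩ else x
  have hextn : ∀ y, ext y n = x := fun y => by simp [ext]
  have hext : ∀ k, Continuous fun y => ext y k := by
    intro k
    by_cases h : k < n
    · simp only [ext, h, dite_true]; exact continuous_apply _
    · simp only [ext, h, dite_false]; exact continuous_const
  have hcont : Continuous fun y => discreteAction H w a τ n (ext y) := by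
    refine (hw.comp (hext 0)).add (continuous_finsetSum _ fun k _ => continuous_const.mul ?_)
    exact hH.continuous_lag continuous_const (hext _) (((hext _).sub (hext _)).div_const _)
  have hcoer : Tendsto (fun y => discreteAction H w a τ n (ext y)) (cocompact _) atTop := by
    rw [← Metric.cobounded_eq_cocompact]
    refine tendsto_atTop_mono (f := fun y => ‖y‖ + (-|x| - W - n * τ * M)) (fun y => ?_)
      (tendsto_atTop_add_const_right _ _ tendsto_norm_cobounded_atTop)
    have h2 : ‖y‖ ≤ discreteAction H w a τ n (ext y) + (|x| + W + n * τ * M) := by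
      have key : ∀ j ≤ n, |ext y j| ≤
          discreteAction H w a τ n (ext y) + (|x| + W + n * τ * M) := by
        intro j hj
        have h1 := le_discreteAction (w := w) hτ hM (X := ext y) hj
        rw [hextn] at h1
        have h3 := (abs_le.1 (hW (ext y 0))).1
        have h4 := abs_sub_abs_le_abs_sub (ext y j) x
        rw [abs_sub_comm] at h4
        linarith
      refine (pi_norm_le_iff_of_nonneg ((abs_nonneg _).trans (key n le_rfl))).2 fun i => ?_
      simpa [ext] using key i i.2.le
    linarith
  obtain ⟨y, hy⟩ := hcont.exists_forall_le hcoer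
  refine ⟨ext y, hextn y, fun Y hY => ?_⟩
  have h1 := hy fun i => Y i
  have h2 : ∀ k ≤ n, ext (fun i => Y i) k = Y k := by
    intro k hk
    by_cases h : k < n
    · simp [ext, h]
    · have : k = n := by omega
      subst this; simp [ext, hY]
  have h3 : discreteAction H w a τ n (ext fun i => Y i) = discreteAction H w a τ n Y := by
    rw [discreteAction, discreteAction, h2 0 (Nat.zero_le _)]
    congr 1
    refine Finset.sum_congr rfl fun k hk => ?_
    have hk' := Finset.mem_range.1 hk
    rw [h2 k hk'.le, h2 (k + 1) hk']
  rwa [h3] at h1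

theorem discreteAction_euler_lagrange (hH : BurgersHyp H) (hw : Differentiable ℝ w) (hτ : 0 < τ)
    {X : ℕ → ℝ} (hX : X n = x)
    (hmin : ∀ Y : ℕ → ℝ, Y n = x → discreteAction H w a τ n X ≤ discreteAction H w a τ n Y)
    {q : ℕ → ℝ} (hq : ∀ k, q k = mom H (a + k * τ) (X (k + 1)) ((X (k + 1) - X k) / τ)) :
    (0 < n → q 0 = deriv w (X 0)) ∧
    ∀ k, k + 1 < n → q (k + 1) = q k - τ * xDeriv H (a + k * τ) (X (k + 1)) (q k) := by
  have key : ∀ h : ℕ → ℝ, h n = 0 → deriv w (X 0) * h 0 + ∑ k ∈ Finset.range n,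
      ((q k - τ * xDeriv H (a + k * τ) (X (k + 1)) (q k)) * h (k + 1) - q k * h k) = 0 := by
    intro h hn
    have h1 : HasDerivAt (fun s => discreteAction H w a τ n fun k => X k + s * h k)
        (deriv w (X 0) * h 0 + ∑ k ∈ Finset.range n, τ *
          (- xDeriv H (a + k * τ) (X (k + 1)) (q k) * h (k + 1) + q k * ((h (k + 1) - h k) / τ)))
        0 := by
      refine HasDerivAt.add ?_ ?_
      · have h2 : HasDerivAt (fun s => X 0 + s * h 0) (h 0) 0 := by
          simpa using ((hasDerivAt_id (0:ℝ)).mul_const (h 0)).const_add (X 0)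
        have h3 : HasDerivAt w (deriv w (X 0)) (X 0 + 0 * h 0) := by
          simpa using (hw (X 0)).hasDerivAt
        exact h3.comp (0:ℝ) h2
      · refine HasDerivAt.fun_sum fun k _ => HasDerivAt.const_mul τ ?_
        have := hH.hasDerivAt_lag (a + k * τ) (X (k + 1)) ((X (k + 1) - X k) / τ) (h (k + 1))
          ((h (k + 1) - h k) / τ)
        rw [← hq k] at this
        refine this.congr_of_eventuallyEq (Eventually.of_forall fun s => ?_)
        dsimp only
        congr 1
        ring
    have h2 : IsLocalMin (fun s => discreteAction H w a τ n fun k => X k + s * h k) 0 := by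
      refine Eventually.of_forall fun s => ?_
      simp only [zero_mul, add_zero]
      exact hmin _ (by simp [hX, hn])
    have h3 := h2.hasDerivAt_eq_zero h1
    rw [← h3]
    congr 1
    refine Finset.sum_congr rfl fun k _ => ?_
    field_simp
    ring
  refine ⟨fun hn => ?_, fun j hj => ?_⟩
  · have := key (Pi.single 0 1) (by simp [hn.ne'])
    rw [Finset.sum_sub_distrib] at this
    simp only [Pi.single_apply, mul_ite, mul_one, mul_zero, Nat.add_eq_zero_iff, one_ne_zero,
      and_false, if_false, if_true, Finset.sum_const_zero, Finset.sum_ite_eq', Finset.mem_range,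
      hn] at this
    linarith
  · have := key (Pi.single (j + 1) 1) (by simp [hj.ne'])
    rw [Finset.sum_sub_distrib] at this
    have hj' : j < n := by omega
    simp only [Pi.single_apply, mul_ite, mul_one, mul_zero, Nat.add_right_cancel_iff, if_true,
      Finset.sum_ite_eq', Finset.mem_range, hj, hj', if_false,
      (Nat.succ_ne_zero j).symm] at this
    linarith

end

/-! ### Curves with an action bound -/

/-- The Lipschitz curve `ξ` on `[s,t]` has action at most `A r' - A r` on each `[r,r'] ⊆ [s,t]`,
in a weak sense expressed by the Fenchel inequality with constant momenta. -/
def SubCurve (H : ℝ → ℝ → ℝ → ℝ) (s t : ℝ) (ξ A : ℝ → ℝ) : Prop :=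
  ∃ B, ∀ r r', s ≤ r → r ≤ r' → r' ≤ t → |ξ r' - ξ r| ≤ B * (r' - r) ∧
    ∀ p, p * (ξ r' - ξ r) - ∫ σ in r..r', H σ (ξ σ) p ≤ A r' - A r

theorem abs_mul_sub_integral_le {f : ℝ → ℝ} {s τ c δ : ℝ} (hτ : 0 ≤ τ)
    (hf : IntervalIntegrable f volume s (s + τ)) (h : ∀ σ ∈ Icc s (s + τ), |c - f σ| ≤ δ) :
    |τ * c - ∫ σ in s..(s + τ), f σ| ≤ τ * δ := by
  have h1 : τ * c - ∫ σ in s..(s + τ), f σ = ∫ σ in s..(s + τ), (c - f σ) := by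
    rw [intervalIntegral.integral_sub (by simp) hf, intervalIntegral.integral_const]
    simp
  rw [h1]
  have h2 := intervalIntegral.norm_integral_le_of_norm_le_const (f := fun σ => c - f σ) (C := δ)
    (a := s) (b := s + τ) (fun σ hσ => by
      rw [uIoc_of_le (by linarith)] at hσ
      exact h σ ⟨hσ.1.le, hσ.2⟩)
  rwa [add_sub_cancel_left, abs_of_nonneg hτ, mul_comm] at h2

namespace SubCurve

variable {H : ℝ → ℝ → ℝ → ℝ} {s t : ℝ} {ξ A : ℝ → ℝ}

theorem exists_lipschitz (h : SubCurve H s t ξ A) :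
    ∃ B, 0 ≤ B ∧ ∀ r ∈ Icc s t, ∀ r' ∈ Icc s t, |ξ r' - ξ r| ≤ B * |r' - r| := by
  obtain ⟨B, hB⟩ := h
  refine ⟨|B|, abs_nonneg _, ?_⟩
  have key : ∀ r ∈ Icc s t, ∀ r' ∈ Icc s t, r ≤ r' → |ξ r' - ξ r| ≤ |B| * |r' - r| := by
    intro r hr r' hr' hrr
    rw [abs_of_nonneg (sub_nonneg.2 hrr)]
    refine (hB r r' hr.1 hrr hr'.2).1.trans ?_
    have := sub_nonneg.2 hrr
    gcongr
    exact le_abs_self B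
  intro r hr r' hr'
  rcases le_total r r' with h | h
  · exact key r hr r' hr' h
  · rw [abs_sub_comm, abs_sub_comm r' r]
    exact key r' hr' r hr h

theorem continuousOn (h : SubCurve H s t ξ A) : ContinuousOn ξ (Icc s t) := by
  obtain ⟨B, hB0, hB⟩ := h.exists_lipschitz
  have : LipschitzOnWith ⟨B, hB0⟩ ξ (Icc s t) :=
    LipschitzOnWith.of_dist_le_mul fun x hx y hy => hB y hy x hx
  exact this.continuousOn

theorem intervalIntegrable (hH : BurgersHyp H) (h : SubCurve H s t ξ A) {r r' : ℝ}
    (hr : r ∈ Icc s t) (hr' : r' ∈ Icc s t) (p : ℝ) :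
    IntervalIntegrable (fun σ => H σ (ξ σ) p) volume r r' := by
  refine ContinuousOn.intervalIntegrable ?_
  have h1 : ContinuousOn ξ (uIcc r r') := h.continuousOn.mono (uIcc_subset_Icc hr hr')
  exact hH.smooth.continuous.comp_continuousOn
    (continuousOn_id.prodMk (h1.prodMk continuousOn_const))

theorem discreteAction_le (hH : BurgersHyp H) (h : SubCurve H s t ξ A) (hst : s ≤ t) :
    ∃ C, ∀ (w : ℝ → ℝ) (n : ℕ) (τ : ℝ), 0 < τ → s + n * τ = t →
      discreteAction H w s τ n (fun k => ξ (s + k * τ)) ≤ w (ξ s) + (A t - A s) + C * τ := by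
  obtain ⟨B, hB0, hB⟩ := h.exists_lipschitz
  obtain ⟨R, hR⟩ := hH.exists_mom_bound s t B
  obtain ⟨C, hC⟩ := exists_lipOnStrip (hH.smooth.of_le (by norm_num)) hH.per_x s t R
  have hR0 : 0 ≤ R := (abs_nonneg _).trans (hR s ⟨le_rfl, hst⟩ 0 0 (by simpa using hB0))
  have hC0 : 0 ≤ C := hC.nonneg hst hR0
  refine ⟨(t - s) * (C * (1 + B)), fun w n τ hτ hn => ?_⟩
  have hmem : ∀ k : ℕ, k ≤ n → s + k * τ ∈ Icc s t := by
    intro k hk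
    have h1 : (k : ℝ) ≤ n := by exact_mod_cast hk
    have h2 : (k : ℝ) * τ ≤ n * τ := by gcongr
    have h3 : (0:ℝ) ≤ k * τ := by positivity
    exact ⟨by linarith, by linarith⟩
  have hterm : ∀ k ∈ Finset.range n,
      τ * Lag H (s + k * τ) (ξ (s + (k + 1 : ℕ) * τ))
        ((ξ (s + (k + 1 : ℕ) * τ) - ξ (s + k * τ)) / τ) ≤
      (A (s + (k + 1 : ℕ) * τ) - A (s + k * τ)) + τ * (C * (1 + B) * τ) := by
    intro k hk
    have hk' := Finset.mem_range.1 hk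
    have m0 := hmem k hk'.le
    have m1 := hmem (k + 1) hk'
    have e : s + (k + 1 : ℕ) * τ = s + k * τ + τ := by push_cast; ring
    rw [e] at m1 ⊢
    set r := s + k * τ
    set v := (ξ (r + τ) - ξ r) / τ with hv
    have hvB : |v| ≤ B := by
      rw [hv, abs_div, abs_of_pos hτ, div_le_iff₀ hτ]
      have := hB r m0 (r + τ) m1
      rwa [add_sub_cancel_left, abs_of_pos hτ] at this
    have hτv : τ * v = ξ (r + τ) - ξ r := mul_div_cancel₀ _ hτ.ne'
    set q := mom H r (ξ (r + τ)) v
    have hq : |q| ≤ R := hR r m0 _ _ hvB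
    have h1 := hH.lag_eq' r (ξ (r + τ)) v
    obtain ⟨B', hB'⟩ := h
    have h2 := (hB' r (r + τ) m0.1 (by linarith) m1.2).2 q
    have h3 := abs_mul_sub_integral_le (f := fun σ => H σ (ξ σ) q) (s := r)
      (c := H r (ξ (r + τ)) q) (δ := C * (1 + B) * τ) hτ.le
      (SubCurve.intervalIntegrable hH ⟨B', hB'⟩ m0 m1 q) (fun σ hσ => by
        have hσ' : σ ∈ Icc s t := ⟨m0.1.trans hσ.1, hσ.2.trans m1.2⟩
        refine (hC.2 r m0 σ hσ' (ξ (r + τ)) (ξ σ) q q hq hq).trans ?_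
        rw [sub_self, abs_zero, add_zero, mul_assoc]
        have h4 := hB σ hσ' (r + τ) m1
        have h5 : |r - σ| ≤ τ := by rw [abs_le]; constructor <;> linarith [hσ.1, hσ.2]
        have h6 : |r + τ - σ| ≤ τ := by rw [abs_le]; constructor <;> linarith [hσ.1, hσ.2]
        have h7 : B * |r + τ - σ| ≤ B * τ := by gcongr
        gcongr
        linarith)
    have h4 := (abs_le.1 h3).1
    change Lag H r (ξ (r + τ)) v = q * v - H r (ξ (r + τ)) q at h1
    rw [h1]
    have : τ * (q * v - H r (ξ (r + τ)) q) = q * (ξ (r + τ) - ξ r) - τ * H r (ξ (r + τ)) q := by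
      rw [← hτv]; ring
    linarith
  have hsum := Finset.sum_le_sum hterm
  rw [Finset.sum_add_distrib, Finset.sum_range_sub (fun k : ℕ => A (s + k * τ)), Finset.sum_const,
    Finset.card_range, nsmul_eq_mul, hn] at hsum
  have e1 : (n : ℝ) * (τ * (C * (1 + B) * τ)) = (t - s) * (C * (1 + B)) * τ := by
    rw [← hn]; ring
  rw [e1] at hsum
  simp only [discreteAction, Nat.cast_zero, zero_mul, add_zero] at hsum ⊢
  linarith

end SubCurve

/-! ### Minimizing orbits -/

section

variable {H : ℝ → ℝ → ℝ → ℝ} {w : ℝ → ℝ}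

/-- Discrete minimizers are close to orbits. -/
theorem IsOrbit.discrete_minimizer_close (hH : BurgersHyp H) {γ : ℝ → ℝ × ℝ} (hγ : IsOrbit H γ)
    {a b R Λ C τ e x : ℝ} {n : ℕ} (hab : a ≤ b) (hR : ∀ t ∈ Icc a b, |(γ t).2| ≤ R)
    (hR0 : 0 ≤ R)
    (hΛ : VFLip H a b (R + 1) Λ) (hC : LipOnStrip (momLag H) a b (R + 1) C) (hτ : 0 < τ)
    (hn : a + n * τ = b) (hn0 : 0 < n) (hw : Differentiable ℝ w) {X : ℕ → ℝ} (hX : X n = x)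
    (hmin : ∀ Y : ℕ → ℝ, Y n = x → discreteAction H w a τ n X ≤ discreteAction H w a τ n Y)
    (h0 : ‖(X 0, deriv w (X 0)) - γ a‖ ≤ e) {E : ℝ}
    (hE : E = Real.exp (Λ * (b - a)) * (e + (Λ ^ 2 + Λ * (1 + Λ)) * τ * (b - a))) (hE1 : E ≤ 1) :
    |x - (γ b).1| ≤ E ∧
    |discreteAction H w a τ n X - w (X 0) - ∫ t in a..b, momLag H t (γ t).1 (γ t).2| ≤
      (b - a) * (C * (τ + 2 * (E + Λ * τ))) := by
  have hΛ0 := hΛ.1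
  set q : ℕ → ℝ := fun k => mom H (a + k * τ) (X (k + 1)) ((X (k + 1) - X k) / τ) with hq
  obtain ⟨hq0, hq1⟩ := discreteAction_euler_lagrange hH hw hτ hX hmin (q := q) fun k => rfl
  have hXs : ∀ k, X (k + 1) - X k = τ * pDeriv H (a + k * τ) (X (k + 1)) (q k) := by
    intro k
    rw [hH.pDeriv_mom, mul_div_cancel₀ _ hτ.ne']
  set Z : ℕ → ℝ × ℝ := fun k => (X k, if k < n then q k else
    q (n - 1) - τ * xDeriv H (a + (n - 1 : ℕ) * τ) (X (n - 1 + 1)) (q (n - 1))) with hZ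
  have hZq : ∀ k < n, Z k = (X k, q k) := fun k hk => by simp [hZ, hk]
  have hZs : ∀ k < n, Z (k + 1) - Z k = τ • HamVF H (a + k * τ) (X (k + 1), q k) := by
    intro k hk
    rw [hZq k hk, HamVF_eq]
    refine Prod.ext (by simpa [hZ] using hXs k) ?_
    simp only [hZ, Prod.snd_sub, Prod.smul_snd, smul_eq_mul]
    split_ifs with h
    · rw [hq1 k h]; ring
    · have : n - 1 = k := by omega
      rw [this]; ring
  have hmem : ∀ k : ℕ, k ≤ n → a + k * τ ∈ Icc a b := by
    intro k hk
    have h1 : (k : ℝ) ≤ n := by exact_mod_cast hk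
    have h2 : (k : ℝ) * τ ≤ n * τ := by gcongr
    have h3 : (0:ℝ) ≤ k * τ := by positivity
    exact ⟨by linarith, by linarith⟩
  have hstep : ∀ k < n, |q k| ≤ R + 1 → |X (k + 1) - X k| ≤ τ * Λ := by
    intro k hk hqk
    rw [hXs, abs_mul, abs_of_pos hτ]
    gcongr
    exact (norm_fst_le (HamVF H (a + k * τ) (X (k + 1), q k))).trans
      (hΛ.2.1 _ (hmem k hk.le) _ hqk)
  have hEul : ∀ k < n, |(Z k).2| ≤ R + 1 →
      ‖Z (k + 1) - Z k - τ • HamVF H (a + k * τ) (Z k)‖ ≤ Λ ^ 2 * τ ^ 2 := by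
    intro k hk hqk
    rw [hZs k hk, ← smul_sub, norm_smul, Real.norm_eq_abs, abs_of_pos hτ]
    rw [hZq k hk] at hqk ⊢
    have h1 := hΛ.2.2 _ (hmem k hk.le) _ (hmem k hk.le) (X (k + 1), q k) (X k, q k) hqk hqk
    rw [sub_self, abs_zero, zero_add] at h1
    have h2 : ‖((X (k + 1), q k) : ℝ × ℝ) - (X k, q k)‖ ≤ τ * Λ := by
      rw [Prod.mk_sub_mk, sub_self, Prod.norm_def]
      simpa using hstep k hk hqk
    calc _ ≤ τ * (Λ * (τ * Λ)) := by gcongr; exact h1.trans (by gcongr)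
      _ = _ := by ring
  have hclose := hγ.norm_euler_sub_le (e := e) (C := Λ ^ 2) (Z := Z) hR hΛ hτ.le hn.le
    (by positivity) hEul (by rw [hZq 0 hn0, hq0 hn0]; exact h0) (by rw [← hE]; exact hE1)
  rw [← hE] at hclose
  have hE0 : 0 ≤ E := (norm_nonneg _).trans (hclose 0 (Nat.zero_le _))
  refine ⟨?_, ?_⟩
  · have := (norm_fst_le (Z n - γ (a + n * τ))).trans (hclose n le_rfl)
    rw [hn] at this
    simpa [hZ, hX] using this
  · have hcont : Continuous fun t => momLag H t (γ t).1 (γ t).2 :=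
      hH.continuous_momLag continuous_id hγ.continuous_fst hγ.continuous_snd
    have hint : ∫ t in a..b, momLag H t (γ t).1 (γ t).2 = ∑ k ∈ Finset.range n,
        ∫ t in (a + k * τ)..(a + (k + 1 : ℕ) * τ), momLag H t (γ t).1 (γ t).2 := by
      have := intervalIntegral.sum_integral_adjacent_intervals (μ := volume)
        (f := fun t => momLag H t (γ t).1 (γ t).2) (a := fun k : ℕ => a + k * τ) (n := n)
        (fun k _ => hcont.intervalIntegrable _ _)
      rw [this, hn]; simp
    rw [hint, discreteAction, add_sub_cancel_left, ← Finset.sum_sub_distrib]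
    refine (Finset.abs_sum_le_sum_abs _ _).trans ?_
    have hterm : ∀ k ∈ Finset.range n, |τ * Lag H (a + k * τ) (X (k + 1)) ((X (k + 1) - X k) / τ) -
        ∫ t in (a + k * τ)..(a + (k + 1 : ℕ) * τ), momLag H t (γ t).1 (γ t).2| ≤
        τ * (C * (τ + 2 * (E + Λ * τ))) := by
      intro k hk
      have hk' := Finset.mem_range.1 hk
      have m0 := hmem k hk'.le
      have m1 := hmem (k + 1) hk'
      have hcl := hclose k hk'.le
      have hcl1 := hclose (k + 1) hk'
      have es : a + (k + 1 : ℕ) * τ = a + k * τ + τ := by push_cast; ring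
      rw [es] at m1 hcl1 ⊢
      set s := a + k * τ
      rw [hH.lag_eq]
      change |τ * momLag H s (X (k + 1)) (q k) - _| ≤ _
      have hqs : |q k - (γ s).2| ≤ E := by
        have := (norm_snd_le (Z k - γ s)).trans hcl
        rw [hZq k hk'] at this
        exact this
      have hxs : |X (k + 1) - (γ (s + τ)).1| ≤ E := (norm_fst_le (Z (k + 1) - γ (s + τ))).trans hcl1
      have hqR : |q k| ≤ R + 1 := by
        have h3 := abs_add_le (q k - (γ s).2) (γ s).2
        rw [sub_add_cancel] at h3
        linarith [hR s m0]
      have hsub : Icc s (s + τ) ⊆ Icc a b := Icc_subset_Icc m0.1 m1.2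
      have hbd : ∀ r ∈ Icc s (s + τ), ∀ r' ∈ Icc s (s + τ), ‖γ r' - γ r‖ ≤ Λ * τ := by
        intro r hr r' hr'
        have := (convex_Icc s (s + τ)).norm_image_sub_le_of_norm_hasDerivWithin_le
          (fun r _ => (hγ r).hasDerivWithinAt)
          (fun r hr => hΛ.2.1 r (hsub hr) _ ((hR r (hsub hr)).trans (by linarith))) hr hr'
        refine this.trans ?_
        have : ‖r' - r‖ ≤ τ := by
          rw [Real.norm_eq_abs, abs_le]; constructor <;> linarith [hr.1, hr.2, hr'.1, hr'.2]
        gcongr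
      refine abs_mul_sub_integral_le hτ.le (hcont.intervalIntegrable _ _) fun σ hσ => ?_
      have hs0 : s ∈ Icc s (s + τ) := ⟨le_rfl, by linarith⟩
      have hs1 : s + τ ∈ Icc s (s + τ) := ⟨by linarith, le_rfl⟩
      have hC0 : 0 ≤ C := hC.nonneg hab (by linarith)
      refine (hC.2 s m0 σ (hsub hσ) _ _ _ _ hqR ((hR σ (hsub hσ)).trans (by linarith))).trans ?_
      have a1 : |s - σ| ≤ τ := by rw [abs_le]; constructor <;> linarith [hσ.1, hσ.2]
      have a2 : |X (k + 1) - (γ σ).1| ≤ E + Λ * τ := by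
        have := abs_sub_le (X (k + 1)) (γ (s + τ)).1 (γ σ).1
        have h2 := (norm_fst_le (γ (s + τ) - γ σ)).trans (hbd σ hσ _ hs1)
        rw [Real.norm_eq_abs, Prod.fst_sub] at h2
        linarith
      have a3 : |q k - (γ σ).2| ≤ E + Λ * τ := by
        have := abs_sub_le (q k) (γ s).2 (γ σ).2
        have h2 := (norm_snd_le (γ s - γ σ)).trans (hbd σ hσ _ hs0)
        rw [Real.norm_eq_abs, Prod.snd_sub] at h2
        linarith
      exact mul_le_mul_of_nonneg_left (by linarith) hC0
    refine (Finset.sum_le_sum hterm).trans (le_of_eq ?_)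
    rw [Finset.sum_const, Finset.card_range, nsmul_eq_mul, ← hn]
    ring

end

/-- `γ` is an orbit minimizing the action on `[a,b]`, with initial cost `w`, among the curves with
the same endpoint. -/
structure IsMinimizing (H : ℝ → ℝ → ℝ → ℝ) (w : ℝ → ℝ) (a b : ℝ) (γ : ℝ → ℝ × ℝ) : Prop where
  orbit : IsOrbit H γ
  transversal : (γ a).2 = deriv w (γ a).1
  minimal : ∀ ξ A, SubCurve H a b ξ A → ξ b = (γ b).1 →
    w (γ a).1 + ∫ t in a..b, momLag H t (γ t).1 (γ t).2 ≤ w (ξ a) + (A b - A a)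

theorem exists_bound_of_periodic {w : ℝ → ℝ} (hw : Continuous w) (hper : ∀ x, w (x + 1) = w x) :
    ∃ W, 0 ≤ W ∧ ∀ x, |w x| ≤ W := by
  obtain ⟨W, hW⟩ := exists_bound_on_strip (F := fun _ x _ => w x) (by fun_prop)
    (fun _ x _ => hper x) 0 0 0
  have h : ∀ x, |w x| ≤ W := fun x => hW 0 (by simp) x 0 (by simp)
  exact ⟨W, (abs_nonneg _).trans (h 0), h⟩

theorem exists_isMinimizing {H : ℝ → ℝ → ℝ → ℝ} (hH : BurgersHyp H) {w : ℝ → ℝ}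
    (hw : ContDiff ℝ 1 w) (hper : ∀ x, w (x + 1) = w x) {a b : ℝ} (hab : a ≤ b) (x : ℝ) :
    ∃ γ, IsMinimizing H w a b γ ∧ (γ b).1 = x := by
  rcases hab.eq_or_lt with rfl | hlt
  · obtain ⟨γ, hγ, hγa⟩ := hH.exists_orbit a (x, deriv w x)
    exact ⟨γ, ⟨hγ, by simp [hγa], fun ξ A _ hξ => by simp [hξ]⟩, by simp [hγa]⟩
  obtain ⟨W, hW0, hW⟩ := exists_bound_of_periodic hw.continuous hper
  obtain ⟨M, hM⟩ := hH.exists_le_lag a b 1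
  obtain ⟨N, hN⟩ := hH.exists_lag_bound a b 0
  set τ : ℕ → ℝ := fun n => (b - a) / (n + 1 : ℕ) with hτdef
  have hn0 : ∀ n : ℕ, (0:ℝ) < (n + 1 : ℕ) := fun n => by positivity
  have hτ : ∀ n, 0 < τ n := fun n => div_pos (by linarith) (hn0 n)
  have hτn : ∀ n : ℕ, a + (n + 1 : ℕ) * τ n = b := fun n => by
    rw [hτdef]; simp only; rw [mul_div_cancel₀ _ (hn0 n).ne']; ring
  have hτ0 : Tendsto τ atTop (𝓝 0) :=
    (tendsto_const_div_atTop_nhds_zero_nat (b - a)).comp (tendsto_add_atTop_nat 1)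
  have hmem : ∀ n k : ℕ, k < n + 1 → a + k * τ n ∈ Icc a b := by
    intro n k hk
    have h1 : (k : ℝ) ≤ (n + 1 : ℕ) := by exact_mod_cast hk.le
    have h2 : (k : ℝ) * τ n ≤ (n + 1 : ℕ) * τ n := by gcongr
    have h3 : (0:ℝ) ≤ k * τ n := mul_nonneg (by positivity) (hτ n).le
    exact ⟨by linarith, by linarith [hτn n]⟩
  have hM' : ∀ n : ℕ, ∀ k < n + 1, ∀ x v, |v| - M ≤ Lag H (a + k * τ n) x v := by
    intro n k hk y v
    simpa using hM _ (hmem n k hk) y v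
  choose X hX hXmin using fun n : ℕ =>
    exists_discreteAction_min hH hw.continuous hW (hτ n) (hM' n) x
  have hX0 : ∀ n, X n 0 ∈
      Icc (x - (2 * W + (b - a) * (N + M))) (x + (2 * W + (b - a) * (N + M))) := by
    intro n
    have h1 := le_discreteAction (w := w) (hτ n) (hM' n) (X := X n) (Nat.zero_le (n + 1))
    have h2 := hXmin n (fun _ => x) rfl
    have h3 : discreteAction H w a (τ n) (n + 1) (fun _ => x) ≤ W + (n + 1 : ℕ) * τ n * N := by
      refine add_le_add ((le_abs_self _).trans (hW x)) ?_
      refine (Finset.sum_le_card_nsmul _ _ (τ n * N) fun k hk => ?_).trans (le_of_eq ?_)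
      · have := (le_abs_self _).trans
          (hN _ (hmem n k (Finset.mem_range.1 hk)) x ((x - x) / τ n) (by simp))
        have h4 := (hτ n).le
        gcongr
      · rw [Finset.card_range, nsmul_eq_mul]; ring
    have h4 := (abs_le.1 (hW (X n 0))).1
    have h5 : ((n + 1 : ℕ) : ℝ) * τ n = b - a := by linarith [hτn n]
    rw [hX, h5] at h1
    rw [h5] at h3
    have h6 : |x - X n 0| ≤ 2 * W + (b - a) * (N + M) := by linarith
    rw [abs_le] at h6
    exact ⟨by linarith [h6.2], by linarith [h6.1]⟩
  obtain ⟨y, -, φ, hφ, hy⟩ := isCompact_Icc.tendsto_subseq hX0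
  obtain ⟨γ, hγ, hγa⟩ := hH.exists_orbit a (y, deriv w y)
  obtain ⟨R, hR0, hR⟩ := hγ.exists_bound a b
  obtain ⟨Λ, hΛ⟩ := hH.exists_vfLip a b (R + 1)
  obtain ⟨C, hC⟩ := exists_lipOnStrip hH.contDiff_momLag hH.momLag_add_one a b (R + 1)
  have hτφ : Tendsto (fun n => τ (φ n)) atTop (𝓝 0) := hτ0.comp hφ.tendsto_atTop
  set e : ℕ → ℝ := fun n => ‖(X (φ n) 0, deriv w (X (φ n) 0)) - γ a‖ with he
  have hdw : Continuous (deriv w) := hw.continuous_deriv (by norm_num)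
  have he0 : Tendsto e atTop (𝓝 0) := by
    have h1 : Continuous fun z => ‖((z, deriv w z) : ℝ × ℝ) - γ a‖ := by fun_prop
    have h2 := (h1.tendsto y).comp hy
    simp only [hγa, sub_self, norm_zero] at h2
    simp only [he, hγa]
    exact h2
  set E : ℕ → ℝ := fun n => Real.exp (Λ * (b - a)) *
    (e n + (Λ ^ 2 + Λ * (1 + Λ)) * τ (φ n) * (b - a)) with hE
  have hE0 : Tendsto E atTop (𝓝 0) := by
    have := (he0.add ((hτφ.const_mul (Λ ^ 2 + Λ * (1 + Λ))).mul_const (b - a))).const_mul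
      (Real.exp (Λ * (b - a)))
    simpa using this
  have hev : ∀ᶠ n in atTop, E n ≤ 1 := (hE0.eventually (gt_mem_nhds one_pos)).mono fun _ h => h.le
  have hclose : ∀ᶠ n in atTop, |x - (γ b).1| ≤ E n ∧
      |discreteAction H w a (τ (φ n)) (φ n + 1) (X (φ n)) - w (X (φ n) 0) -
        ∫ t in a..b, momLag H t (γ t).1 (γ t).2| ≤
        (b - a) * (C * (τ (φ n) + 2 * (E n + Λ * τ (φ n)))) :=
    hev.mono fun n hn => hγ.discrete_minimizer_close hH hab hR hR0 hΛ hC (hτ _) (hτn _)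
      (Nat.succ_pos _) (hw.differentiable (by norm_num)) (hX _) (hXmin _) le_rfl rfl hn
  have hγb : (γ b).1 = x := by
    have := ge_of_tendsto hE0 (hclose.mono fun n h => h.1)
    linarith [abs_nonpos_iff.1 this]
  refine ⟨γ, ⟨hγ, by simp [hγa], fun ξ A hξ hξb => ?_⟩, hγb⟩
  obtain ⟨C', hC'⟩ := hξ.discreteAction_le hH hab
  have hlim1 : Tendsto (fun n => w (X (φ n) 0) + ∫ t in a..b, momLag H t (γ t).1 (γ t).2) atTop
      (𝓝 (w (γ a).1 + ∫ t in a..b, momLag H t (γ t).1 (γ t).2)) := by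
    have := (hw.continuous.tendsto y).comp hy
    simpa [hγa] using this.add_const _
  have hlim2 : Tendsto (fun n => w (ξ a) + (A b - A a) + C' * τ (φ n) +
      (b - a) * (C * (τ (φ n) + 2 * (E n + Λ * τ (φ n))))) atTop (𝓝 (w (ξ a) + (A b - A a))) := by
    have h1 := (hτφ.add ((hE0.add (hτφ.const_mul Λ)).const_mul 2)).const_mul C
    have h2 := ((hτφ.const_mul C').const_add (w (ξ a) + (A b - A a))).add (h1.const_mul (b - a))
    simpa using h2
  refine le_of_tendsto_of_tendsto hlim1 hlim2 (hclose.mono fun n h => ?_)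
  have h1 := (abs_le.1 h.2).1
  have h2 := hXmin (φ n) (fun k => ξ (a + k * τ (φ n))) (by rw [hτn, hξb, hγb])
  have h3 := hC' w (φ n + 1) (τ (φ n)) (hτ _) (hτn _)
  dsimp only
  linarith

namespace SubCurve

variable {H : ℝ → ℝ → ℝ → ℝ} {s t : ℝ} {ξ A : ℝ → ℝ}

theorem of_hasDerivAt (hH : BurgersHyp H) {g : ℝ → ℝ} (hξ : ∀ t, HasDerivAt ξ (g t) t)
    (hg : Continuous g) (s t r₀ : ℝ) :
    SubCurve H s t ξ (fun r => ∫ σ in r₀..r, Lag H σ (ξ σ) (g σ)) := by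
  obtain ⟨B, hB⟩ := isCompact_Icc.exists_bound_of_continuousOn (hg.continuousOn (s := Icc s t))
  have hξc : Continuous ξ := continuous_iff_continuousAt.2 fun t => (hξ t).continuousAt
  refine ⟨B, fun r r' hr hrr hr' => ⟨?_, fun p => ?_⟩⟩
  · have := (convex_Icc r r').norm_image_sub_le_of_norm_hasDerivWithin_le
      (fun r _ => (hξ r).hasDerivWithinAt)
      (fun q hq => hB q ⟨hr.trans hq.1, hq.2.trans hr'⟩) (left_mem_Icc.2 hrr) (right_mem_Icc.2 hrr)
    rwa [Real.norm_eq_abs, Real.norm_eq_abs, abs_of_nonneg (sub_nonneg.2 hrr)] at this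
  · have hL : Continuous fun σ => Lag H σ (ξ σ) (g σ) := hH.continuous_lag continuous_id hξc hg
    have hHc : Continuous fun σ => H σ (ξ σ) p := hH.continuous_H continuous_id hξc continuous_const
    have hpg : Continuous fun σ => p * g σ := continuous_const.mul hg
    have hd : Continuous fun σ => p * g σ - H σ (ξ σ) p := hpg.sub hHc
    rw [intervalIntegral.integral_interval_sub_left (hL.intervalIntegrable _ _)
      (hL.intervalIntegrable _ _),
      ← intervalIntegral.integral_eq_sub_of_hasDerivAt (fun r _ => hξ r)
        (hg.intervalIntegrable _ _), ← intervalIntegral.integral_const_mul,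
      ← intervalIntegral.integral_sub (hpg.intervalIntegrable _ _) (hHc.intervalIntegrable _ _)]
    exact intervalIntegral.integral_mono_on hrr (hd.intervalIntegrable _ _)
      (hL.intervalIntegrable _ _) fun σ _ => hH.le_lag _ _ _ _

theorem add_const (hH : BurgersHyp H) (h : SubCurve H s t ξ A) (n : ℤ) :
    SubCurve H s t (fun r => ξ r + n) A := by
  obtain ⟨B, hB⟩ := h
  refine ⟨B, fun r r' hr hrr hr' => ?_⟩
  simpa only [add_sub_add_right_eq_sub, add_intCast_of_periodic hH.per_x] using hB r r' hr hrr hr'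

theorem concat (hH : BurgersHyp H) {a : ℝ} {η C : ℝ → ℝ} (has : a ≤ s) (hst : s ≤ t)
    (h₁ : SubCurve H a s ξ A) (h₂ : SubCurve H s t η C) (hs : ξ s = η s) :
    ∃ ζ D, SubCurve H a t ζ D ∧ ζ a = ξ a ∧ ζ t = η t ∧
      D t - D a = (A s - A a) + (C t - C s) := by
  set ζ : ℝ → ℝ := fun r => if r ≤ s then ξ r else η r with hζ
  set D : ℝ → ℝ := fun r => if r ≤ s then A r else A s + (C r - C s) with hD
  have z1 : ∀ r, r ≤ s → ζ r = ξ r := fun r hr => by simp [hζ, hr]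
  have d1 : ∀ r, r ≤ s → D r = A r := fun r hr => by simp [hD, hr]
  have z2 : ∀ r, s ≤ r → ζ r = η r := fun r hr => by
    rcases hr.eq_or_lt with rfl | hr
    · rw [z1 _ le_rfl, hs]
    · simp [hζ, hr.not_ge]
  have d2 : ∀ r, s ≤ r → D r = A s + (C r - C s) := fun r hr => by
    rcases hr.eq_or_lt with rfl | hr
    · rw [d1 _ le_rfl]; ring
    · simp [hD, hr.not_ge]
  refine ⟨ζ, D, ?_, z1 a has, z2 t hst, by rw [d1 a has, d2 t hst]; ring⟩
  obtain ⟨B₁, hB₁⟩ := id h₁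
  obtain ⟨B₂, hB₂⟩ := id h₂
  have i1 : ∀ r r' p, r ≤ r' → r' ≤ s →
      ∫ σ in r..r', H σ (ζ σ) p = ∫ σ in r..r', H σ (ξ σ) p := fun r r' p hrr hr' => by
    refine intervalIntegral.integral_congr fun σ hσ => ?_
    rw [uIcc_of_le hrr] at hσ
    simp only [z1 σ (hσ.2.trans hr')]
  have i2 : ∀ r r' p, r ≤ r' → s ≤ r →
      ∫ σ in r..r', H σ (ζ σ) p = ∫ σ in r..r', H σ (η σ) p := fun r r' p hrr hr' => by
    refine intervalIntegral.integral_congr fun σ hσ => ?_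
    rw [uIcc_of_le hrr] at hσ
    simp only [z2 σ (hr'.trans hσ.1)]
  have k1 : ∀ r r', a ≤ r → r ≤ r' → r' ≤ s → |ζ r' - ζ r| ≤ max B₁ B₂ * (r' - r) ∧
      ∀ p, p * (ζ r' - ζ r) - ∫ σ in r..r', H σ (ζ σ) p ≤ D r' - D r := by
    intro r r' hr hrr hr'
    have := hB₁ r r' hr hrr hr'
    refine ⟨?_, fun p => ?_⟩
    · rw [z1 r' hr', z1 r (hrr.trans hr')]
      exact this.1.trans (mul_le_mul_of_nonneg_right (le_max_left _ _) (by linarith))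
    · rw [i1 r r' p hrr hr', z1 r' hr', z1 r (hrr.trans hr'), d1 r' hr', d1 r (hrr.trans hr')]
      exact this.2 p
  have k2 : ∀ r r', s ≤ r → r ≤ r' → r' ≤ t → |ζ r' - ζ r| ≤ max B₁ B₂ * (r' - r) ∧
      ∀ p, p * (ζ r' - ζ r) - ∫ σ in r..r', H σ (ζ σ) p ≤ D r' - D r := by
    intro r r' hr hrr hr'
    have := hB₂ r r' hr hrr hr'
    refine ⟨?_, fun p => ?_⟩
    · rw [z2 r hr, z2 r' (hr.trans hrr)]
      exact this.1.trans (mul_le_mul_of_nonneg_right (le_max_right _ _) (by linarith))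
    · rw [i2 r r' p hrr hr, z2 r hr, z2 r' (hr.trans hrr), d2 r hr, d2 r' (hr.trans hrr)]
      have := this.2 p
      linarith
  refine ⟨max B₁ B₂, fun r r' hr hrr hr' => ?_⟩
  rcases le_total r' s with h | h
  · exact k1 r r' hr hrr h
  rcases le_total s r with h' | h'
  · exact k2 r r' h' hrr hr'
  have e1 := k1 r s hr h' le_rfl
  have e2 := k2 s r' le_rfl h hr'
  refine ⟨?_, fun p => ?_⟩
  · have := abs_add_le (ζ r' - ζ s) (ζ s - ζ r)
    rw [sub_add_sub_cancel] at this
    linarith [e1.1, e2.1]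
  · have i3 : IntervalIntegrable (fun σ => H σ (ζ σ) p) volume r s :=
      (h₁.intervalIntegrable hH ⟨hr, h'⟩ ⟨has, le_rfl⟩ p).congr (fun σ hσ => by
        rw [uIoc_of_le h'] at hσ
        simp only [z1 σ hσ.2])
    have i4 : IntervalIntegrable (fun σ => H σ (ζ σ) p) volume s r' :=
      (h₂.intervalIntegrable hH ⟨le_rfl, hst⟩ ⟨h, hr'⟩ p).congr (fun σ hσ => by
        rw [uIoc_of_le h] at hσ
        simp only [z2 σ hσ.1.le])
    rw [← intervalIntegral.integral_add_adjacent_intervals i3 i4]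
    linarith [e1.2 p, e2.2 p]

end SubCurve

theorem IsOrbit.subCurve {H : ℝ → ℝ → ℝ → ℝ} (hH : BurgersHyp H) {γ : ℝ → ℝ × ℝ}
    (hγ : IsOrbit H γ) (s t r₀ : ℝ) :
    SubCurve H s t (fun r => (γ r).1) (fun r => ∫ σ in r₀..r, momLag H σ (γ σ).1 (γ σ).2) := by
  have := SubCurve.of_hasDerivAt hH hγ.hasDerivAt_fst
    (hH.continuous_pDeriv continuous_id hγ.continuous_fst hγ.continuous_snd) s t r₀
  simpa only [id, hH.lag_pDeriv] using this

theorem IsOrbit.continuous_momLag {H : ℝ → ℝ → ℝ → ℝ} (hH : BurgersHyp H) {γ : ℝ → ℝ × ℝ}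
    (hγ : IsOrbit H γ) : Continuous fun σ => momLag H σ (γ σ).1 (γ σ).2 :=
  hH.continuous_momLag continuous_id hγ.continuous_fst hγ.continuous_snd

/-! ### The value function -/

/-- The value function with initial value `w` at time `a`. -/
noncomputable def value (H : ℝ → ℝ → ℝ → ℝ) (w : ℝ → ℝ) (a t x : ℝ) : ℝ :=
  sInf {v | ∃ ξ A, SubCurve H a t ξ A ∧ ξ t = x ∧ v = w (ξ a) + (A t - A a)}

section

variable {H : ℝ → ℝ → ℝ → ℝ} {w : ℝ → ℝ} {a t : ℝ}

theorem IsMinimizing.value_eq (hH : BurgersHyp H) {γ : ℝ → ℝ × ℝ} (hγ : IsMinimizing H w a t γ) :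
    value H w a t (γ t).1 = w (γ a).1 + ∫ σ in a..t, momLag H σ (γ σ).1 (γ σ).2 := by
  refine IsLeast.csInf_eq ⟨⟨_, _, hγ.orbit.subCurve hH a t a, rfl, by simp⟩, ?_⟩
  rintro _ ⟨ξ, A, h, hξ, rfl⟩
  exact hγ.minimal ξ A h hξ

theorem value_le (hH : BurgersHyp H) (hw : ContDiff ℝ 1 w)
    (hper : ∀ x, w (x + 1) = w x) (hat : a ≤ t) {ξ A : ℝ → ℝ} (h : SubCurve H a t ξ A) :
    value H w a t (ξ t) ≤ w (ξ a) + (A t - A a) := by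
  obtain ⟨γ, hγ, hγt⟩ := exists_isMinimizing hH hw hper hat (ξ t)
  rw [← hγt, hγ.value_eq hH]
  exact hγ.minimal ξ A h hγt.symm

theorem value_self (hH : BurgersHyp H) (hw : ContDiff ℝ 1 w)
    (hper : ∀ x, w (x + 1) = w x) (x : ℝ) : value H w a a x = w x := by
  obtain ⟨γ, hγ, hγt⟩ := exists_isMinimizing hH hw hper (le_refl a) x
  rw [← hγt, hγ.value_eq hH]
  simp

theorem value_le_add (hH : BurgersHyp H) (hw : ContDiff ℝ 1 w)
    (hper : ∀ x, w (x + 1) = w x) {t' : ℝ} (hat : a ≤ t) (htt : t ≤ t') {ξ A : ℝ → ℝ}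
    (h : SubCurve H t t' ξ A) :
    value H w a t' (ξ t') ≤ value H w a t (ξ t) + (A t' - A t) := by
  obtain ⟨γ, hγ, hγt⟩ := exists_isMinimizing hH hw hper hat (ξ t)
  obtain ⟨ζ, D, hζ, h1, h2, h3⟩ := (hγ.orbit.subCurve hH a t a).concat hH hat htt h hγt
  have := value_le hH hw hper (hat.trans htt) hζ
  rw [h1, h2, h3] at this
  rw [← hγt, hγ.value_eq hH]
  simp only [intervalIntegral.integral_same, sub_zero] at this
  linarith

theorem IsMinimizing.value_eq_add {γ : ℝ → ℝ × ℝ} (hγ : IsMinimizing H w a t γ)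
    (hH : BurgersHyp H) (hw : ContDiff ℝ 1 w) (hper : ∀ x, w (x + 1) = w x) {s s' : ℝ}
    (hs : a ≤ s) (hss : s ≤ s') (hs' : s' ≤ t) : value H w a s' (γ s').1 =
      value H w a s (γ s).1 + ∫ σ in s..s', momLag H σ (γ σ).1 (γ σ).2 := by
  have hc := hγ.orbit.continuous_momLag hH
  have hi : ∀ r r', IntervalIntegrable (fun σ => momLag H σ (γ σ).1 (γ σ).2) volume r r' :=
    fun _ _ => hc.intervalIntegrable _ _
  have h1 := value_le hH hw hper hs (hγ.orbit.subCurve hH a s a)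
  have h2 := value_le_add hH hw hper hs hss (hγ.orbit.subCurve hH s s' s)
  have h3 := value_le_add hH hw hper (hs.trans hss) hs' (hγ.orbit.subCurve hH s' t s')
  have h4 := hγ.value_eq hH
  rw [← intervalIntegral.integral_add_adjacent_intervals (hi a s) (hi s t),
    ← intervalIntegral.integral_add_adjacent_intervals (hi s s') (hi s' t)] at h4
  simp only [intervalIntegral.integral_same, sub_zero] at h1 h2 h3
  linarith

theorem value_add_one (hH : BurgersHyp H) (hper : ∀ x, w (x + 1) = w x) (a t x : ℝ) :
    value H w a t (x + 1) = value H w a t x := by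
  have hp : Function.Periodic w 1 := hper
  have key : ∀ n : ℤ, ∀ x v, (∃ ξ A, SubCurve H a t ξ A ∧ ξ t = x ∧ v = w (ξ a) + (A t - A a)) →
      ∃ ξ A, SubCurve H a t ξ A ∧ ξ t = x + n ∧ v = w (ξ a) + (A t - A a) := by
    rintro n x v ⟨ξ, A, h, hx, hv⟩
    refine ⟨_, A, h.add_const hH n, by rw [hx], ?_⟩
    have : w (ξ a + n) = w (ξ a) := by simpa using hp.int_mul n (ξ a)
    rw [this, hv]
  refine congrArg sInf (Set.ext fun v => ⟨fun h => ?_, fun h => ?_⟩)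
  · simpa using key (-1) _ v h
  · simpa using key 1 _ v h

/-- Uniform Lipschitz bound on `[a,b] × ℝ`, for every `b`. -/
def LipOnStrips (a : ℝ) (u : ℝ → ℝ → ℝ) : Prop :=
  ∀ b, ∃ L, 0 ≤ L ∧ ∀ t ∈ Icc a b, ∀ t' ∈ Icc a b, ∀ x x',
    |u t x - u t' x'| ≤ L * (|t - t'| + |x - x'|)

theorem value_lipOnStrips (hH : BurgersHyp H) (hw : ContDiff ℝ 1 w)
    (hper : ∀ x, w (x + 1) = w x) : LipOnStrips a (value H w a) := by
  intro b
  rcases lt_or_ge b a with hb | hab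
  · exact ⟨0, le_rfl, fun t ht => absurd (ht.1.trans ht.2) hb.not_ge⟩
  have hdw : Continuous (deriv w) := hw.continuous_deriv (by norm_num)
  obtain ⟨K, hK0, hK⟩ := exists_bound_of_periodic hdw fun x => by
    have : w = fun y => w (y + 1) := funext fun y => (hper y).symm
    conv_rhs => rw [this, deriv_comp_add_const w 1 x]
  obtain ⟨K', hK'⟩ := hH.exists_orbit_bound a b K
  obtain ⟨R, hR⟩ := exists_bound_on_strip hH.contDiff_pDeriv.continuous hH.pDeriv_add_one a b K'
  obtain ⟨C, hC0, hC⟩ := hH.exists_lag_lipschitz a b R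
  obtain ⟨N, hN⟩ := hH.exists_lag_bound a b R
  have hminb : ∀ t ∈ Icc a b, ∀ γ, IsMinimizing H w a t γ → ∀ s ∈ Icc a b,
      |pDeriv H s (γ s).1 (γ s).2| ≤ R := by
    intro t ht γ hγ s hs
    exact hR s hs _ _ (hK' γ hγ.orbit a ⟨le_rfl, hab⟩ (by rw [hγ.transversal]; exact hK _) s hs)
  have hR0 : 0 ≤ R := by
    obtain ⟨γ, hγ, -⟩ := exists_isMinimizing hH hw hper (le_refl a) 0
    exact (abs_nonneg _).trans (hminb a ⟨le_rfl, hab⟩ γ hγ a ⟨le_rfl, hab⟩)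
  have hN0 : 0 ≤ N := (abs_nonneg _).trans (hN a ⟨le_rfl, hab⟩ 0 0 (by simpa using hR0))
  set Lx := K + C * (b - a) with hLx
  have hLx0 : 0 ≤ Lx := by
    have := sub_nonneg.2 hab
    positivity
  have hx : ∀ t ∈ Icc a b, ∀ x x', value H w a t x' ≤ value H w a t x + Lx * |x - x'| := by
    intro t ht x x'
    obtain ⟨γ, hγ, rfl⟩ := exists_isMinimizing hH hw hper ht.1 x
    have hgc : Continuous fun s => pDeriv H s (γ s).1 (γ s).2 :=
      hH.continuous_pDeriv continuous_id hγ.orbit.continuous_fst hγ.orbit.continuous_snd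
    set d := x' - (γ t).1 with hd
    have h1 := value_le hH hw hper ht.1 (SubCurve.of_hasDerivAt hH
      (ξ := fun s => (γ s).1 + d) (fun s => (hγ.orbit.hasDerivAt_fst s).add_const d) hgc a t a)
    rw [hγ.value_eq hH]
    have h2 : w ((γ a).1 + d) ≤ w (γ a).1 + K * |d| := by
      have := (convex_univ).norm_image_sub_le_of_norm_hasDerivWithin_le (f := w)
        (fun r _ => ((hw.differentiable (by norm_num)) r).hasDerivAt.hasDerivWithinAt)
        (fun q _ => hK q) (mem_univ (γ a).1) (mem_univ ((γ a).1 + d))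
      rw [add_sub_cancel_left] at this
      have := (le_abs_self _).trans this
      rw [Real.norm_eq_abs] at this
      linarith
    have h3 : ∫ σ in a..t, Lag H σ ((γ σ).1 + d) (pDeriv H σ (γ σ).1 (γ σ).2) ≤
        ∫ σ in a..t, (momLag H σ (γ σ).1 (γ σ).2 + C * |d|) := by
      refine intervalIntegral.integral_mono_on ht.1 ?_ ?_ fun σ hσ => ?_
      · exact (hH.continuous_lag continuous_id (hγ.orbit.continuous_fst.add continuous_const)
          hgc).intervalIntegrable _ _
      · exact ((hγ.orbit.continuous_momLag hH).add continuous_const).intervalIntegrable _ _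
      · have hσ' : σ ∈ Icc a b := ⟨hσ.1, hσ.2.trans ht.2⟩
        have := hC σ hσ' ((γ σ).1 + d) (γ σ).1 _ (hminb t ht γ hγ σ hσ')
        rwa [hH.lag_pDeriv, add_sub_cancel_left] at this
    rw [intervalIntegral.integral_add ((hγ.orbit.continuous_momLag hH).intervalIntegrable _ _)
      (continuous_const.intervalIntegrable _ _), intervalIntegral.integral_const, smul_eq_mul] at h3
    have h4 : (t - a) * (C * |d|) ≤ (b - a) * (C * |d|) := by
      have := ht.2
      gcongr
    simp only [intervalIntegral.integral_same, sub_zero] at h1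
    have e : (γ t).1 + d = x' := by rw [hd]; ring
    rw [e] at h1
    rw [abs_sub_comm, ← hd, hLx]
    linarith
  have ht : ∀ t ∈ Icc a b, ∀ t' ∈ Icc a b, t ≤ t' → ∀ x,
      |value H w a t x - value H w a t' x| ≤ (N + Lx * R) * (t' - t) := by
    intro t ht t' ht' htt x
    have hbd : ∀ f : ℝ → ℝ, (∀ s ∈ Icc t t', |f s| ≤ N) → |∫ s in t..t', f s| ≤ N * (t' - t) := by
      intro f hf
      have := intervalIntegral.norm_integral_le_of_norm_le_const (f := f) (C := N)
        (a := t) (b := t') (fun σ hσ => by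
          rw [uIoc_of_le htt] at hσ
          exact hf σ ⟨hσ.1.le, hσ.2⟩)
      rwa [abs_of_nonneg (sub_nonneg.2 htt)] at this
    have hsub : ∀ s ∈ Icc t t', s ∈ Icc a b := fun s hs => ⟨ht.1.trans hs.1, hs.2.trans ht'.2⟩
    have hd := sub_nonneg.2 htt
    have hp : 0 ≤ Lx * R * (t' - t) := by positivity
    rw [abs_le]
    constructor
    · have h1 := value_le_add hH hw hper ht.1 htt (SubCurve.of_hasDerivAt hH
        (ξ := fun _ => x) (fun s => hasDerivAt_const s x) continuous_const t t' t)
      simp only [intervalIntegral.integral_same, sub_zero] at h1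
      have h2 := (le_abs_self _).trans (hbd (fun σ => Lag H σ x 0)
        fun s hs => hN s (hsub s hs) _ _ (by simpa using hR0))
      linarith
    · obtain ⟨γ, hγ, rfl⟩ := exists_isMinimizing hH hw hper ht'.1 x
      have h1 := hγ.value_eq_add hH hw hper ht.1 htt le_rfl
      have h2 := (neg_le_abs _).trans (hbd (fun σ => momLag H σ (γ σ).1 (γ σ).2) fun s hs => by
        rw [← hH.lag_pDeriv]
        exact hN s (hsub s hs) _ _ (hminb t' ht' γ hγ s (hsub s hs)))
      have h3 := hx t ht (γ t).1 (γ t').1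
      have h4 := (convex_Icc t t').norm_image_sub_le_of_norm_hasDerivWithin_le
        (fun r _ => (hγ.orbit.hasDerivAt_fst r).hasDerivWithinAt)
        (fun q hq => hminb t' ht' γ hγ q (hsub q hq)) (right_mem_Icc.2 htt) (left_mem_Icc.2 htt)
      rw [Real.norm_eq_abs, Real.norm_eq_abs, abs_sub_comm t t', abs_of_nonneg hd] at h4
      have h5 : Lx * |(γ t).1 - (γ t').1| ≤ Lx * (R * (t' - t)) := by gcongr
      linarith
  refine ⟨N + Lx * R + Lx, by positivity, fun t ht1 t' ht1' x x' => ?_⟩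
  have h1 : |value H w a t x - value H w a t' x| ≤ (N + Lx * R) * |t - t'| := by
    rcases le_total t t' with h | h
    · rw [abs_sub_comm t, abs_of_nonneg (sub_nonneg.2 h)]; exact ht t ht1 t' ht1' h x
    · rw [abs_sub_comm, abs_of_nonneg (sub_nonneg.2 h)]; exact ht t' ht1' t ht1 h x
  have h2 : |value H w a t' x - value H w a t' x'| ≤ Lx * |x - x'| := by
    have e1 := hx t' ht1' x x'
    have e2 := hx t' ht1' x' x
    rw [abs_sub_comm x' x] at e2
    rw [abs_le]; constructor <;> linarith
  have h3 := abs_sub_le (value H w a t x) (value H w a t' x) (value H w a t' x')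
  have h4 : 0 ≤ (N + Lx * R) * |x - x'| := by positivity
  have h5 : 0 ≤ Lx * |t - t'| := by positivity
  linarith

end

theorem HasDerivAt.nonpos_of_eventually_le {G : ℝ → ℝ} {G' t : ℝ} (hG : HasDerivAt G G' t)
    (h : ∀ᶠ r in 𝓝[<] t, G t ≤ G r) : G' ≤ 0 := by
  have h1 := (hasDerivWithinAt_iff_tendsto_slope' (notMem_Iio.2 le_rfl)).1
    (hG.hasDerivWithinAt (s := Iio t))
  refine le_of_tendsto h1 ?_
  filter_upwards [h, self_mem_nhdsWithin] with r hr hrt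
  rw [slope_def_field]
  exact div_nonpos_of_nonneg_of_nonpos (sub_nonneg.2 hr) (sub_nonpos.2 (mem_Iio.1 hrt).le)

theorem ContDiff.hasDerivAt_along {φ : ℝ × ℝ → ℝ} (hφ : ContDiff ℝ 1 φ) {ξ : ℝ → ℝ} {v t : ℝ}
    (hξ : HasDerivAt ξ v t) :
    HasDerivAt (fun r => φ (r, ξ r)) (fderiv ℝ φ (t, ξ t) (1, 0) + v * fderiv ℝ φ (t, ξ t) (0, 1))
      t := by
  have h := ((hφ.differentiable (by norm_num)) (t, ξ t)).hasFDerivAt.comp_hasDerivAt t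
    ((hasDerivAt_id t).prodMk hξ)
  have e : ((1 : ℝ), v) = (1, 0) + v • ((0 : ℝ), (1 : ℝ)) := by simp
  rwa [e, map_add, map_smul, smul_eq_mul] at h

theorem LipOnStrips.continuousOn {a : ℝ} {u : ℝ → ℝ → ℝ} (h : LipOnStrips a u) :
    ContinuousOn (fun z : ℝ × ℝ => u z.1 z.2) (Ici a ×ˢ univ) := by
  intro z hz
  obtain ⟨L, hL0, hL⟩ := h (z.1 + 1)
  rw [ContinuousWithinAt, tendsto_iff_dist_tendsto_zero]
  have h0 : Tendsto (fun y : ℝ × ℝ => L * (|y.1 - z.1| + |y.2 - z.2|)) (𝓝[Ici a ×ˢ univ] z)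
      (𝓝 0) := by
    have : Continuous fun y : ℝ × ℝ => L * (|y.1 - z.1| + |y.2 - z.2|) := by fun_prop
    have := (this.tendsto z).mono_left (nhdsWithin_le_nhds (s := Ici a ×ˢ univ))
    simpa using this
  refine tendsto_of_tendsto_of_tendsto_of_le_of_le' tendsto_const_nhds h0
    (Eventually.of_forall fun _ => dist_nonneg) ?_
  have h1 : ∀ᶠ y : ℝ × ℝ in 𝓝 z, y.1 < z.1 + 1 :=
    (continuous_fst.tendsto z).eventually (gt_mem_nhds (lt_add_one _))
  filter_upwards [self_mem_nhdsWithin, mem_nhdsWithin_of_mem_nhds h1] with y hy hy1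
  exact hL _ ⟨hy.1, hy1.le⟩ _ ⟨hz.1, by linarith⟩ _ _

section

variable {H : ℝ → ℝ → ℝ → ℝ} {w : ℝ → ℝ} {a : ℝ}

theorem value_viscSubSol (hH : BurgersHyp H) (hw : ContDiff ℝ 1 w) (hper : ∀ x, w (x + 1) = w x) :
    ViscSubSol H 0 0 (Ioi a ×ˢ univ) (value H w a) := by
  rintro φ hφ ⟨t, x⟩ ⟨hat, -⟩ hmax
  simp only [zero_add]
  set p := fderiv ℝ φ (t, x) (0, 1) with hp
  set v := pDeriv H t x p with hv
  have hξ : ∀ r, HasDerivAt (fun r => x + v * (r - t)) v r := fun r => by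
    simpa using (((hasDerivAt_id r).sub_const t).const_mul v).const_add x
  have hξc : Continuous fun r => x + v * (r - t) := by fun_prop
  have hL : Continuous fun σ => Lag H σ (x + v * (σ - t)) v :=
    hH.continuous_lag continuous_id hξc continuous_const
  have h1 := (hφ.hasDerivAt_along (hξ t)).sub (hL.integral_hasStrictDerivAt t t).hasDerivAt
  have h2 := h1.nonpos_of_eventually_le (by
    have hc : Tendsto (fun r => (r, x + v * (r - t))) (𝓝 t) (𝓝 (t, x)) := by
      have : Continuous fun r => (r, x + v * (r - t)) := by fun_prop
      simpa using this.tendsto t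
    filter_upwards [mem_nhdsWithin_of_mem_nhds (hc.eventually hmax),
      mem_nhdsWithin_of_mem_nhds (lt_mem_nhds hat), self_mem_nhdsWithin] with r hr har hrt
    have h3 := value_le_add hH hw hper har.le (le_of_lt hrt)
      (SubCurve.of_hasDerivAt hH hξ continuous_const r t r)
    simp only [intervalIntegral.integral_same, sub_zero, sub_self, mul_zero, add_zero] at h3
    simp only [Pi.sub_apply, sub_self, mul_zero, add_zero, intervalIntegral.integral_same,
      sub_zero] at hr ⊢
    rw [intervalIntegral.integral_symm]
    linarith)
  simp only [sub_self, mul_zero, add_zero] at h2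
  rw [hv, hH.lag_pDeriv, momLag, ← hv, ← hp] at h2
  linarith

theorem value_viscSuperSol (hH : BurgersHyp H) (hw : ContDiff ℝ 1 w)
    (hper : ∀ x, w (x + 1) = w x) :
    ViscSuperSol H 0 0 (Ioi a ×ˢ univ) (value H w a) := by
  rintro φ hφ ⟨t, x⟩ ⟨hat, -⟩ hmin
  simp only [zero_add]
  have hat' : a < t := hat
  obtain ⟨γ, hγ, rfl⟩ := exists_isMinimizing hH hw hper hat'.le x
  have hL := hγ.orbit.continuous_momLag hH
  have h1 := ((hφ.hasDerivAt_along (hγ.orbit.hasDerivAt_fst t)).sub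
    (hL.integral_hasStrictDerivAt t t).hasDerivAt).neg
  have h2 := h1.nonpos_of_eventually_le (by
    have hc : Tendsto (fun r => (r, (γ r).1)) (𝓝 t) (𝓝 (t, (γ t).1)) :=
      (continuous_id.prodMk hγ.orbit.continuous_fst).tendsto t
    filter_upwards [mem_nhdsWithin_of_mem_nhds (hc.eventually hmin),
      mem_nhdsWithin_of_mem_nhds (lt_mem_nhds hat), self_mem_nhdsWithin] with r hr har hrt
    have h3 := hγ.value_eq_add hH hw hper har.le (le_of_lt hrt) le_rfl
    simp only [Pi.sub_apply, Pi.neg_apply, intervalIntegral.integral_same, sub_zero] at hr ⊢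
    rw [intervalIntegral.integral_symm]
    linarith)
  have h4 := hH.le_momLag t (γ t).1 (γ t).2 (fderiv ℝ φ (t, (γ t).1) (0, 1))
  linarith

theorem value_isViscSolOn (hH : BurgersHyp H) (hw : ContDiff ℝ 1 w)
    (hper : ∀ x, w (x + 1) = w x) : IsViscSolOn H 0 a (value H w a) :=
  ⟨(value_lipOnStrips hH hw hper).continuousOn, value_add_one hH hper a,
    value_viscSubSol hH hw hper, value_viscSuperSol hH hw hper⟩

end

/-! ### Comparison of viscosity sub- and supersolutions -/

section

variable {u : ℝ → ℝ → ℝ} {a : ℝ}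

theorem ContinuousOn.continuous_clamp
    (hu : ContinuousOn (fun z : ℝ × ℝ => u z.1 z.2) (Ici a ×ˢ univ)) :
    Continuous fun z : ℝ × ℝ => u (max a z.1) z.2 :=
  hu.comp_continuous (f := fun z : ℝ × ℝ => (max a z.1, z.2)) (by fun_prop)
    fun z => ⟨le_max_left a z.1, mem_univ z.2⟩

theorem add_intCast_of_periodic' (hper : ∀ t x, u t (x + 1) = u t x) (t x : ℝ) (n : ℤ) :
    u t (x + n) = u t x := by
  have h : Function.Periodic (u t) 1 := hper t
  simpa using h.int_mul n x

theorem exists_bound_on_Icc (hu : ContinuousOn (fun z : ℝ × ℝ => u z.1 z.2) (Ici a ×ˢ univ))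
    (hper : ∀ t x, u t (x + 1) = u t x) (b : ℝ) : ∃ M, ∀ t ∈ Icc a b, ∀ x, |u t x| ≤ M := by
  obtain ⟨M, hM⟩ := exists_bound_on_strip (F := fun t x _ => u (max a t) x)
    (hu.continuous_clamp.comp (by fun_prop : Continuous fun q : ℝ × ℝ × ℝ => (q.1, q.2.1)))
    (fun t x _ => hper _ x) a b 0
  refine ⟨M, fun t ht x => ?_⟩
  have := hM t ht x 0 (by simp)
  rwa [max_eq_right ht.1] at this

theorem exists_modulus_on_Icc (hu : ContinuousOn (fun z : ℝ × ℝ => u z.1 z.2) (Ici a ×ˢ univ))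
    (hper : ∀ t x, u t (x + 1) = u t x) (b : ℝ) {e : ℝ} (he : 0 < e) :
    ∃ δ, 0 < δ ∧ ∀ t ∈ Icc a b, ∀ t' ∈ Icc a b, ∀ x x', |t - t'| < δ → |x - x'| < δ →
      |u t x - u t' x'| < e := by
  have h1 : UniformContinuousOn (fun z : ℝ × ℝ => u z.1 z.2) (Icc a b ×ˢ Icc (-1) 2) :=
    (isCompact_Icc.prod isCompact_Icc).uniformContinuousOn_of_continuous
      (hu.mono (prod_mono Icc_subset_Ici_self (subset_univ _)))
  obtain ⟨δ, hδ, h⟩ := Metric.uniformContinuousOn_iff.1 h1 e he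
  refine ⟨min δ 1, by positivity, fun t ht t' ht' x x' htt hxx => ?_⟩
  have e1 := add_intCast_of_periodic' hper t (Int.fract x) ⌊x⌋
  have e2 := add_intCast_of_periodic' hper t' (x' - ⌊x⌋) ⌊x⌋
  rw [Int.fract_add_floor] at e1
  rw [sub_add_cancel] at e2
  rw [e1, e2]
  have h2 := Int.fract_nonneg x
  have h3 := Int.fract_lt_one x
  have e3 : x - x' = Int.fract x - (x' - ⌊x⌋) := by rw [Int.fract]; ring
  rw [e3] at hxx
  have h4 := abs_lt.1 (hxx.trans_le (min_le_right δ 1))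
  refine h (t, Int.fract x) ⟨ht, by constructor <;> linarith⟩ (t', x' - ⌊x⌋)
    ⟨ht', by constructor <;> linarith⟩ ?_
  rw [Prod.dist_eq, max_lt_iff, Real.dist_eq, Real.dist_eq]
  exact ⟨htt.trans_le (min_le_left _ _), hxx.trans_le (min_le_left _ _)⟩

end

theorem exists_doubled_max {f h : ℝ → ℝ → ℝ} {a T ε : ℝ} (hε : 0 < ε) (hε1 : ε ≤ 1)
    (hf : ContinuousOn (fun z : ℝ × ℝ => f z.1 z.2) (Ici a ×ˢ univ))
    (hh : ContinuousOn (fun z : ℝ × ℝ => h z.1 z.2) (Ici a ×ˢ univ))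
    (hfp : ∀ t x, f t (x + 1) = f t x) (hhp : ∀ t x, h t (x + 1) = h t x)
    {b : ℝ → ℝ} (hb : Continuous b) (hb0 : ∀ t, 0 ≤ b t) {t₁ x₁ : ℝ} (ht₁ : t₁ ∈ Icc a T)
    (hpos : 0 < f t₁ x₁ - h t₁ x₁ - b t₁) :
    ∃ t' ∈ Icc a T, ∃ s' ∈ Icc a T, ∃ x' y', ∀ t ∈ Icc a T, ∀ s ∈ Icc a T, ∀ x y,
      f t x - h s y - ((t - s) ^ 2 + (x - y) ^ 2) / (2 * ε) - b t ≤
        f t' x' - h s' y' - ((t' - s') ^ 2 + (x' - y') ^ 2) / (2 * ε) - b t' := by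
  obtain ⟨M₁, hM₁⟩ := exists_bound_on_Icc hf hfp T
  obtain ⟨M₂, hM₂⟩ := exists_bound_on_Icc hh hhp T
  have h1 : 0 ≤ M₁ := (abs_nonneg _).trans (hM₁ t₁ ht₁ 0)
  have h2 : 0 ≤ M₂ := (abs_nonneg _).trans (hM₂ t₁ ht₁ 0)
  set r := M₁ + M₂ + 2 with hr
  set Φ : ℝ → ℝ → ℝ → ℝ → ℝ := fun t x s y =>
    f t x - h s y - ((t - s) ^ 2 + (x - y) ^ 2) / (2 * ε) - b t with hΦ
  set C : Set (ℝ × ℝ × ℝ × ℝ) := Icc a T ×ˢ Icc 0 1 ×ˢ Icc a T ×ˢ Icc (-r) (r + 1) with hC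
  have hCc : IsCompact C :=
    isCompact_Icc.prod (isCompact_Icc.prod (isCompact_Icc.prod isCompact_Icc))
  have hcont : ContinuousOn (fun q : ℝ × ℝ × ℝ × ℝ => Φ q.1 q.2.1 q.2.2.1 q.2.2.2) C := by
    have c1 : ContinuousOn (fun q : ℝ × ℝ × ℝ × ℝ => f q.1 q.2.1) C :=
      hf.comp (f := fun q : ℝ × ℝ × ℝ × ℝ => (q.1, q.2.1)) (by fun_prop)
        fun q hq => ⟨hq.1.1, mem_univ _⟩
    have c2 : ContinuousOn (fun q : ℝ × ℝ × ℝ × ℝ => h q.2.2.1 q.2.2.2) C :=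
      hh.comp (f := fun q : ℝ × ℝ × ℝ × ℝ => (q.2.2.1, q.2.2.2)) (by fun_prop)
        fun q hq => ⟨hq.2.2.1.1, mem_univ _⟩
    have c3 : Continuous (fun q : ℝ × ℝ × ℝ × ℝ =>
        ((q.1 - q.2.2.1) ^ 2 + (q.2.1 - q.2.2.2) ^ 2) / (2 * ε)) := by fun_prop
    have c4 : Continuous (fun q : ℝ × ℝ × ℝ × ℝ => b q.1) := by fun_prop
    exact ((c1.sub c2).sub c3.continuousOn).sub c4.continuousOn
  have hshift : ∀ t x s y, Φ t x s y = Φ t (Int.fract x) s (y - ⌊x⌋) := by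
    intro t x s y
    have e1 := add_intCast_of_periodic' hfp t (Int.fract x) ⌊x⌋
    have e2 := add_intCast_of_periodic' hhp s (y - ⌊x⌋) ⌊x⌋
    rw [Int.fract_add_floor] at e1
    rw [sub_add_cancel] at e2
    simp only [hΦ]
    rw [e1, e2, show Int.fract x - (y - ⌊x⌋) = x - y by rw [Int.fract]; ring]
  have hfr : ∀ x : ℝ, Int.fract x ∈ Icc (0 : ℝ) 1 := fun x =>
    ⟨Int.fract_nonneg x, (Int.fract_lt_one x).le⟩
  have hmem : (t₁, Int.fract x₁, t₁, x₁ - ⌊x₁⌋) ∈ C := by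
    have := hfr x₁
    refine ⟨ht₁, this, ht₁, ?_⟩
    rw [show x₁ - ⌊x₁⌋ = Int.fract x₁ from rfl]
    exact ⟨by linarith [this.1], by linarith [this.2]⟩
  obtain ⟨⟨t', x', s', y'⟩, ⟨ht', -, hs', -⟩, hmax⟩ :=
    hCc.exists_isMaxOn ⟨_, hmem⟩ hcont
  refine ⟨t', ht', s', hs', x', y', fun t ht s hs x y => ?_⟩
  change Φ t x s y ≤ Φ t' x' s' y'
  rw [hshift]
  by_cases hy : y - ⌊x⌋ ∈ Icc (-r) (r + 1)
  · exact hmax (a := (t, Int.fract x, s, y - ⌊x⌋)) ⟨ht, hfr x, hs, hy⟩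
  have h3 : 0 < Φ t' x' s' y' := by
    refine lt_of_lt_of_le ?_ (hmax hmem)
    change 0 < Φ _ _ _ _
    rw [← hshift]
    simpa [hΦ] using hpos
  refine le_trans ?_ h3.le
  have h4 : r ^ 2 ≤ (Int.fract x - (y - ⌊x⌋)) ^ 2 := by
    have := hfr x
    rw [sq_le_sq, abs_of_nonneg (by linarith : 0 ≤ r), le_abs]
    rcases not_and_or.1 hy with hy | hy
    · exact Or.inl (by linarith [this.1])
    · exact Or.inr (by linarith [this.2])
  have h5 : r ^ 2 / 2 ≤ ((t - s) ^ 2 + (Int.fract x - (y - ⌊x⌋)) ^ 2) / (2 * ε) := by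
    rw [le_div_iff₀ (by positivity)]
    nlinarith [sq_nonneg (t - s), sq_nonneg r]
  have h6 := (abs_le.1 (hM₁ t ht (Int.fract x))).2
  have h7 := (abs_le.1 (hM₂ s hs (y - ⌊x⌋))).1
  have h8 := hb0 t
  have h9 : M₁ + M₂ ≤ r ^ 2 / 2 := by rw [hr]; nlinarith
  simp only [hΦ]
  linarith

theorem fderiv_add_separated {P Q : ℝ → ℝ} {p q t x : ℝ} (hP : HasDerivAt P p t)
    (hQ : HasDerivAt Q q x) :
    fderiv ℝ (fun z : ℝ × ℝ => P z.1 + Q z.2) (t, x) (1, 0) = p ∧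
      fderiv ℝ (fun z : ℝ × ℝ => P z.1 + Q z.2) (t, x) (0, 1) = q := by
  have h1 := hP.hasFDerivAt.comp (t, x) (hasFDerivAt_fst (𝕜 := ℝ) (p := (t, x)))
  have h2 := hQ.hasFDerivAt.comp (t, x) (hasFDerivAt_snd (𝕜 := ℝ) (p := (t, x)))
  have h3 : HasFDerivAt (fun z : ℝ × ℝ => P z.1 + Q z.2) _ (t, x) := h1.add h2
  rw [h3.fderiv]
  simp

/-- The constants used in the doubling of variables. -/
theorem exists_small_parameter {D C δ η : ℝ} (hD : 0 ≤ D) (hC : 0 ≤ C) (hδ : 0 < δ) (hη : 0 < η) :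
    ∃ ε, 0 < ε ∧ ε ≤ 1 ∧ D * ε < δ ∧ C * (D * ε) < η := by
  set ρ := min δ (η / (C + 1)) with hρ
  have hρ0 : 0 < ρ := by positivity
  have h1 : ρ * (C + 1) ≤ η := by
    rw [← le_div_iff₀ (by positivity)]
    exact min_le_right _ _
  have h2 : min 1 (ρ / (D + 1)) * (D + 1) ≤ ρ := by
    rw [← le_div_iff₀ (by positivity)]
    exact min_le_right _ _
  have h0 : 0 < min 1 (ρ / (D + 1)) := by positivity
  have h3 : D * min 1 (ρ / (D + 1)) < ρ := by nlinarith
  refine ⟨_, h0, min_le_left _ _, h3.trans_le (min_le_left _ _), ?_⟩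
  nlinarith

/-- Comparison principle: a subsolution lies below a supersolution if it does so initially,
provided one of the two is Lipschitz. -/
theorem viscosity_comparison {H : ℝ → ℝ → ℝ → ℝ} (hH : BurgersHyp H) {f h : ℝ → ℝ → ℝ} {a : ℝ}
    (hf : ContinuousOn (fun z : ℝ × ℝ => f z.1 z.2) (Ici a ×ˢ univ))
    (hh : ContinuousOn (fun z : ℝ × ℝ => h z.1 z.2) (Ici a ×ˢ univ))
    (hfp : ∀ t x, f t (x + 1) = f t x) (hhp : ∀ t x, h t (x + 1) = h t x)
    (hsub : ViscSubSol H 0 0 (Ioi a ×ˢ univ) f) (hsup : ViscSuperSol H 0 0 (Ioi a ×ˢ univ) h)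
    (hL : LipOnStrips a f ∨ LipOnStrips a h) (h0 : ∀ x, f a x ≤ h a x) :
    ∀ t, a ≤ t → ∀ x, f t x ≤ h t x := by
  intro t₁ ht₁ x₁
  by_contra! hcon
  set m := f t₁ x₁ - h t₁ x₁ with hm
  have hm0 : 0 < m := sub_pos.2 hcon
  set T := t₁ + 1 with hT
  obtain ⟨M₁, hM₁⟩ := exists_bound_on_Icc hf hfp T
  obtain ⟨M₂, hM₂⟩ := exists_bound_on_Icc hh hhp T
  have ht₁' : t₁ ∈ Icc a T := ⟨ht₁, by linarith⟩
  have hM₁0 : 0 ≤ M₁ := (abs_nonneg _).trans (hM₁ t₁ ht₁' 0)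
  have hM₂0 : 0 ≤ M₂ := (abs_nonneg _).trans (hM₂ t₁ ht₁' 0)
  set β := m / 4 with hβ
  have hβ0 : 0 < β := by positivity
  set k := 2 * (M₁ + M₂) / β + 1 with hk
  have hk0 : 0 < k := by positivity
  set b : ℝ → ℝ := fun t => β * Real.exp (k * (t - t₁)) with hb
  have hbd : ∀ t, HasDerivAt b (k * b t) t := fun t => by
    have := ((((hasDerivAt_id t).sub_const t₁).const_mul k).exp).const_mul β
    refine this.congr_deriv ?_
    simp only [hb, id]
    ring
  have hb0 : ∀ t, 0 < b t := fun t => by positivity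
  have hbmono : Monotone b := fun t t' h => by
    simp only [hb]
    gcongr
  have hbc : ContDiff ℝ 1 b := by fun_prop
  have hbT : ∀ t, t₁ + 1 / 2 ≤ t → M₁ + M₂ < b t := by
    intro t ht
    refine lt_of_lt_of_le ?_ (hbmono ht)
    have h1 := Real.add_one_le_exp (k * (t₁ + 1 / 2 - t₁))
    have h2 : β * (k * (t₁ + 1 / 2 - t₁) + 1) ≤ b (t₁ + 1 / 2) := by
      simp only [hb]
      gcongr
    have h3 : β * k = 2 * (M₁ + M₂) + β := by rw [hk]; field_simp
    nlinarith
  have hbL : ∀ t ∈ Icc a T, ∀ s ∈ Icc a T, |b t - b s| ≤ k * b T * |t - s| := by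
    intro t ht s hs
    refine (convex_Icc a T).norm_image_sub_le_of_norm_hasDerivWithin_le
      (fun r _ => (hbd r).hasDerivWithinAt) (fun r hr => ?_) hs ht
    rw [Real.norm_eq_abs, abs_of_nonneg (by have := hb0 r; positivity)]
    have := hbmono hr.2
    gcongr
  obtain ⟨L, hL0, hLb⟩ : ∃ L, 0 ≤ L ∧ ∀ t ∈ Icc a T, ∀ s ∈ Icc a T, ∀ x y,
      f t x - h s y - b t ≤ max (f t x - h t x - b t) (f s y - h s y - b s) +
        L * (|t - s| + |x - y|) := by
    rcases hL with hL | hL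
    · obtain ⟨L, hL0, hL⟩ := hL T
      refine ⟨L + k * b T, by have := hb0 T; positivity, fun t ht s hs x y => ?_⟩
      have h1 := (le_abs_self _).trans (hL t ht s hs x y)
      have h2 := (neg_le_abs _).trans (hbL t ht s hs)
      have h3 := le_max_right (f t x - h t x - b t) (f s y - h s y - b s)
      have h4 : 0 ≤ k * b T * |x - y| := by have := hb0 T; positivity
      linarith
    · obtain ⟨L, hL0, hL⟩ := hL T
      refine ⟨L, hL0, fun t ht s hs x y => ?_⟩
      have h1 := (le_abs_self _).trans (hL t ht s hs x y)
      have h3 := le_max_left (f t x - h t x - b t) (f s y - h s y - b s)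
      linarith
  obtain ⟨δ₁, hδ₁, hfδ⟩ := exists_modulus_on_Icc hf hfp T (e := m / 4) (by positivity)
  obtain ⟨δ₂, hδ₂, hhδ⟩ := exists_modulus_on_Icc hh hhp T (e := m / 4) (by positivity)
  set D := 4 * L with hD
  have hD0 : 0 ≤ D := by positivity
  obtain ⟨C, hC⟩ := exists_lipOnStrip (hH.smooth.of_le (by norm_num)) hH.per_x a T D
  have hC0 := hC.nonneg (ht₁.trans ht₁'.2) hD0
  obtain ⟨ε, hε, hε1, hεδ, hεη⟩ := exists_small_parameter hD0 hC0
    (δ := min (1 / 2) (min δ₁ δ₂)) (by positivity) (η := k * b a) (by have := hb0 a; positivity)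
  have hbt₁ : b t₁ = m / 4 := by simp [hb, hβ]
  obtain ⟨t, ht, s, hs, x, y, hmax⟩ := exists_doubled_max hε hε1 hf hh hfp hhp hbc.continuous
    (fun t => (hb0 t).le) ht₁' (x₁ := x₁) (by rw [← hm, hbt₁]; linarith)
  have hmain := hmax t₁ ht₁' t₁ ht₁' x₁ x₁
  have hdiag1 := hmax t ht t ht x x
  have hdiag2 := hmax s hs s hs y y
  simp only [sub_self, ne_eq, OfNat.ofNat_ne_zero, not_false_eq_true, zero_pow, add_zero, zero_div,
    sub_zero] at hmain hdiag1 hdiag2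
  rw [← hm, hbt₁] at hmain
  set Q := ((t - s) ^ 2 + (x - y) ^ 2) / (2 * ε) with hQ
  have hQ0 : 0 ≤ Q := by positivity
  have hQL : Q ≤ L * (|t - s| + |x - y|) := by
    have := hLb t ht s hs x y
    have := max_le hdiag1 hdiag2
    linarith
  have hdist : |t - s| + |x - y| ≤ D * ε := by
    rw [hQ, div_le_iff₀ (by positivity), ← sq_abs (t - s), ← sq_abs (x - y)] at hQL
    by_contra! hlt
    have h1 := abs_nonneg (t - s)
    have h2 := abs_nonneg (x - y)
    have h3 : 0 ≤ D * ε := by positivity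
    nlinarith [sq_nonneg (|t - s| - |x - y|)]
  have hts : |t - s| ≤ D * ε := by linarith [abs_nonneg (x - y)]
  have hxy : |x - y| ≤ D * ε := by linarith [abs_nonneg (t - s)]
  have hε2 : D * ε < 1 / 2 := hεδ.trans_le (min_le_left _ _)
  have hε3 : D * ε < δ₁ := hεδ.trans_le ((min_le_right _ _).trans (min_le_left _ _))
  have hε4 : D * ε < δ₂ := hεδ.trans_le ((min_le_right _ _).trans (min_le_right _ _))
  have hbt := hb0 t
  have hta : a < t := by
    refine lt_of_le_of_ne ht.1 fun hta => ?_
    have h1 := h0 x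
    rw [hta] at h1
    have h2 := (le_abs_self _).trans_lt (hhδ t ht s hs x y (hts.trans_lt hε4) (hxy.trans_lt hε4))
    linarith
  have hsa : a < s := by
    refine lt_of_le_of_ne hs.1 fun hsa => ?_
    have h1 := h0 y
    rw [hsa] at h1
    have h2 := (le_abs_self _).trans_lt (hfδ t ht s hs x y (hts.trans_lt hε3) (hxy.trans_lt hε3))
    linarith
  have htT : t < t₁ + 1 / 2 := by
    by_contra! hlt
    have h1 := hbT t hlt
    have h2 := (abs_le.1 (hM₁ t ht x)).2
    have h3 := (abs_le.1 (hM₂ s hs y)).1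
    linarith
  have hsT : s < T := by linarith [(abs_le.1 hts).1]
  have htT' : t < T := by linarith
  have hp : |(x - y) / ε| ≤ D := by
    rw [abs_div, abs_of_pos hε, div_le_iff₀ hε]
    exact hxy
  have hsq : ∀ c r : ℝ, HasDerivAt (fun r => (r - c) ^ 2 / (2 * ε)) ((r - c) / ε) r := fun c r => by
    refine ((((hasDerivAt_id r).sub_const c).pow 2).div_const (2 * ε)).congr_deriv ?_
    simp only [id]
    field_simp
    norm_num
    ring
  have hA := hsub (fun z => ((z.1 - s) ^ 2 / (2 * ε) + b z.1) + (z.2 - y) ^ 2 / (2 * ε))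
    (by fun_prop) (t, x) ⟨hta, mem_univ _⟩ (by
      have hn : ∀ᶠ z : ℝ × ℝ in 𝓝 (t, x), z.1 ∈ Icc a T :=
        (continuous_fst.tendsto (t, x)).eventually (Icc_mem_nhds hta htT')
      filter_upwards [hn] with z hz
      have := hmax z.1 hz s hs z.2 y
      rw [hQ, add_div, add_div] at this
      linarith)
  obtain ⟨hA1, hA2⟩ := fderiv_add_separated ((hsq s t).add (hbd t)) (hsq y x)
  have hB := hsup (fun z => (-((z.1 - t) ^ 2 / (2 * ε))) + (-((z.2 - x) ^ 2 / (2 * ε))))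
    (by fun_prop) (s, y) ⟨hsa, mem_univ _⟩ (by
      have hn : ∀ᶠ z : ℝ × ℝ in 𝓝 (s, y), z.1 ∈ Icc a T :=
        (continuous_fst.tendsto (s, y)).eventually (Icc_mem_nhds hsa hsT)
      filter_upwards [hn] with z hz
      have := hmax t ht z.1 hz x z.2
      rw [hQ, add_div, add_div] at this
      rw [sub_sq_comm z.1 t, sub_sq_comm z.2 x, sub_sq_comm s t, sub_sq_comm y x]
      linarith)
  obtain ⟨hB1, hB2⟩ := fderiv_add_separated (hsq t s).neg (hsq x y).neg
  have hA' : (t - s) / ε + k * b t + H t x (0 + (x - y) / ε) ≤ 0 := by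
    rw [← hA1]
    conv_lhs => rw [← hA2]
    exact hA
  have hB' : 0 ≤ -((s - t) / ε) + H s y (0 + -((y - x) / ε)) := by
    rw [← hB1]
    conv_rhs => rw [← hB2]
    exact hB
  have e1 : -((s - t) / ε) = (t - s) / ε := by ring
  have e2 : -((y - x) / ε) = (x - y) / ε := by ring
  rw [e1, e2] at hB'
  rw [zero_add] at hA' hB'
  have h1 := (neg_le_abs _).trans (hC.2 t ht s hs x y _ _ hp hp)
  rw [sub_self, abs_zero, add_zero] at h1
  have h2 : C * (|t - s| + |x - y|) ≤ C * (D * ε) := by gcongr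
  have h3 : k * b a ≤ k * b t := by
    have := hbmono ht.1
    gcongr
  linarith

/-! ### The value function along absolutely continuous curves -/

theorem AbsolutelyContinuousOnInterval.of_dist_le {f η : ℝ → ℝ} {a b C : ℝ}
    (hη : AbsolutelyContinuousOnInterval η a b)
    (h : ∀ s ∈ uIcc a b, ∀ t ∈ uIcc a b,
      dist (f s) (f t) ≤ C * (dist s t + dist (η s) (η t))) :
    AbsolutelyContinuousOnInterval f a b := by
  have hid : AbsolutelyContinuousOnInterval (fun s : ℝ => s) a b :=
    (LipschitzWith.id.lipschitzOnWith (s := uIcc a b)).absolutelyContinuousOnInterval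
  unfold AbsolutelyContinuousOnInterval at hη hid ⊢
  refine squeeze_zero' (Eventually.of_forall fun _ => Finset.sum_nonneg fun _ _ => dist_nonneg) ?_
    (by simpa using (hid.add hη).const_mul C)
  rw [eventually_inf_principal]
  filter_upwards with E hE
  rw [← Finset.sum_add_distrib, Finset.mul_sum]
  exact Finset.sum_le_sum fun i hi => h _ (hE.1 i hi).1 _ (hE.1 i hi).2

section

variable {H : ℝ → ℝ → ℝ → ℝ} {w : ℝ → ℝ} {a : ℝ}

theorem deriv_value_along_le (hH : BurgersHyp H) (hw : ContDiff ℝ 1 w)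
    (hper : ∀ x, w (x + 1) = w x) {η : ℝ → ℝ} {s v D : ℝ} (has : a ≤ s) (hη : HasDerivAt η v s)
    (hf : HasDerivAt (fun r => value H w a r (η r)) D s) : D ≤ Lag H s (η s) v := by
  obtain ⟨L, hL0, hL⟩ := value_lipOnStrips hH hw hper (s + 1)
  have hξ : ∀ r, HasDerivAt (fun r => η s + v * (r - s)) v r := fun r => by
    simpa using (((hasDerivAt_id r).sub_const s).const_mul v).const_add (η s)
  have hξc : Continuous fun r => η s + v * (r - s) := by fun_prop
  have hLc : Continuous fun σ => Lag H σ (η s + v * (σ - s)) v :=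
    hH.continuous_lag continuous_id hξc continuous_const
  have hI := (hLc.integral_hasStrictDerivAt s s).hasDerivAt
  simp only [sub_self, mul_zero, add_zero] at hI
  have hs : s ∉ Ioi s := notMem_Ioi.2 le_rfl
  have t1 := (hasDerivWithinAt_iff_tendsto_slope' hs).1 (hf.hasDerivWithinAt (s := Ioi s))
  have t2 := (hasDerivWithinAt_iff_tendsto_slope' hs).1 (hI.hasDerivWithinAt (s := Ioi s))
  have t3 := (hasDerivWithinAt_iff_tendsto_slope' hs).1 (hη.hasDerivWithinAt (s := Ioi s))
  have t4 := t2.add (((t3.sub_const v).abs).const_mul L)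
  simp only [sub_self, abs_zero, mul_zero, add_zero] at t4
  refine le_of_tendsto_of_tendsto t1 t4 ?_
  filter_upwards [self_mem_nhdsWithin,
    mem_nhdsWithin_of_mem_nhds (gt_mem_nhds (lt_add_one s))] with r hr hr1
  have hr0 : 0 < r - s := sub_pos.2 hr
  have h1 := value_le_add hH hw hper has (le_of_lt hr)
    (SubCurve.of_hasDerivAt hH hξ continuous_const s r s)
  simp only [intervalIntegral.integral_same, sub_zero, sub_self, mul_zero, add_zero] at h1
  have h2 := (le_abs_self _).trans (hL r ⟨has.trans (le_of_lt hr), hr1.le⟩ r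
    ⟨has.trans (le_of_lt hr), hr1.le⟩ (η r) (η s + v * (r - s)))
  rw [sub_self, abs_zero, zero_add] at h2
  simp only [slope_def_field, intervalIntegral.integral_same, sub_zero]
  have h3 : |(η r - η s) / (r - s) - v| = |η r - (η s + v * (r - s))| / (r - s) := by
    rw [← abs_of_pos hr0, ← abs_div, abs_of_pos hr0]
    congr 1
    field_simp
    ring
  rw [h3, ← mul_div_assoc, ← add_div]
  gcongr
  linarith

theorem value_le_add_of_isAC (hH : BurgersHyp H) (hw : ContDiff ℝ 1 w)
    (hper : ∀ x, w (x + 1) = w x) {b : ℝ} (hab : a ≤ b) {ξ g : ℝ → ℝ} (hξ : IsAC ξ g a b)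
    (hint : IntervalIntegrable (fun s => Lag H s (ξ s) (g s)) volume a b) :
    value H w a b (ξ b) ≤ value H w a a (ξ a) + ∫ s in a..b, Lag H s (ξ s) (g s) := by
  obtain ⟨hg, hξ⟩ := hξ
  set η : ℝ → ℝ := fun r => ξ a + ∫ s in a..r, g s with hη
  set f : ℝ → ℝ := fun r => value H w a r (η r) with hf
  obtain ⟨L, hL0, hL⟩ := value_lipOnStrips hH hw hper b
  have hfac : AbsolutelyContinuousOnInterval f a b := by
    refine (hg.absolutelyContinuousOnInterval_intervalIntegral
      (left_mem_uIcc : a ∈ uIcc a b)).of_dist_le (C := L) fun s hs t ht => ?_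
    rw [uIcc_of_le hab] at hs ht
    have := hL s hs t ht (η s) (η t)
    simp only [hη, add_sub_add_left_eq_sub] at this
    exact this
  have hle : deriv f ≤ᵐ[volume.restrict (Icc a b)] fun s => Lag H s (ξ s) (g s) := by
    rw [EventuallyLE, ae_restrict_iff' measurableSet_Icc]
    filter_upwards [hg.ae_hasDerivAt_integral, hfac.ae_differentiableAt] with s h1 h2 hs
    have hs' : s ∈ uIcc a b := by rwa [uIcc_of_le hab]
    rw [hξ s hs]
    exact deriv_value_along_le hH hw hper hs.1 ((h1 hs' a left_mem_uIcc).const_add (ξ a))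
      (h2 hs').hasDerivAt
  have h3 := intervalIntegral.integral_mono_ae_restrict hab hfac.intervalIntegrable_deriv hint hle
  rw [hfac.integral_deriv_eq_sub] at h3
  have ha : f a = value H w a a (ξ a) := by simp [hf, hη]
  have hb : f b = value H w a b (ξ b) := by
    simp only [hf, hη]
    rw [← hξ b (right_mem_Icc.2 hab)]
  linarith

end

/-! ### Translation of the momentum -/

/-- The Hamiltonian `(t,x,p) ↦ H(t,x,c+p)`. -/
def shiftMom (H : ℝ → ℝ → ℝ → ℝ) (c : ℝ) : ℝ → ℝ → ℝ → ℝ := fun t x p => H t x (c + p)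

section

variable {H : ℝ → ℝ → ℝ → ℝ}

theorem BurgersHyp.shiftMom (hH : BurgersHyp H) (c : ℝ) : BurgersHyp (shiftMom H c) where
  smooth := hH.smooth.comp
    (by fun_prop : ContDiff ℝ 2 fun q : ℝ × ℝ × ℝ => (q.1, q.2.1, c + q.2.2))
  per_t t x p := hH.per_t t x (c + p)
  per_x t x p := hH.per_x t x (c + p)
  convexp t x p := by
    have := hH.convexp t x (c + p)
    have e := iteratedDeriv_comp_const_add 2 (fun q => H t x q) c
    rw [show (fun q => _root_.shiftMom H c t x q) = fun q => H t x (c + q) from rfl, e]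
    exact this
  superlinear t x := by
    rw [tendsto_atTop]
    intro N
    have h1 : Tendsto (fun p : ℝ => c + p) (Bornology.cobounded ℝ) (Bornology.cobounded ℝ) :=
      tendsto_const_add_cobounded c
    have h2 := (tendsto_atTop.1 (hH.superlinear t x) (2 * |N|))
    have h3 : ∀ᶠ p : ℝ in Bornology.cobounded ℝ, 2 * |c| + 1 ≤ |p| :=
      (tendsto_norm_cobounded_atTop (E := ℝ)).eventually (eventually_ge_atTop _)
    filter_upwards [h1.eventually h2, h3] with p h4 h5
    have h6 : |p| ≤ |c + p| + |c| := by
      have := abs_sub (c + p) c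
      rwa [add_sub_cancel_left] at this
    have h7 : 0 < |c + p| := by linarith [abs_nonneg c]
    have h8 : 0 < |p| := by linarith [abs_nonneg c]
    rw [le_div_iff₀ h7] at h4
    rw [le_div_iff₀ h8]
    refine le_trans ?_ h4
    nlinarith [le_abs_self N, abs_nonneg N]
  complete t₀ z₀ := by
    obtain ⟨γ, h, h'⟩ := hH.complete t₀ (z₀ + (0, c))
    refine ⟨fun t => γ t - (0, c), by simp only [h, add_sub_cancel_right], fun t => ?_⟩
    refine ((h' t).sub_const ((0 : ℝ), c)).congr_deriv ?_
    simp only [HamVF, _root_.shiftMom, Prod.fst_sub, Prod.snd_sub, sub_zero, add_sub_cancel]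
    rw [deriv_comp_const_add (fun p => H t (γ t).1 p), add_sub_cancel]

theorem lag_shiftMom (hH : BurgersHyp H) (c t x v : ℝ) :
    Lag (shiftMom H c) t x v = Lag H t x v - c * v := by
  have hs := hH.shiftMom c
  refine le_antisymm ?_ ?_
  · rw [hs.lag_eq']
    have := hH.le_lag t x v (c + mom (shiftMom H c) t x v)
    simp only [shiftMom] at this ⊢
    linarith
  · rw [hH.lag_eq']
    have := hs.le_lag t x v (mom H t x v - c)
    simp only [shiftMom, add_sub_cancel] at this
    linarith

theorem isViscSolOn_shiftMom {c t₀ : ℝ} {u : ℝ → ℝ → ℝ} :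
    IsViscSolOn (shiftMom H c) 0 t₀ u ↔ IsViscSolOn H c t₀ u := by
  simp only [IsViscSolOn, ViscSol, ViscSubSol, ViscSuperSol, shiftMom, zero_add]

end

/-! ### Rotation number -/

theorem tendsto_div_of_forall_subgradient_bound {α R : ℝ → ℝ} {c A t₀ : ℝ} (hα : HasDerivAt α A c)
    (h : ∀ c', ∃ C, ∀ t, t₀ ≤ t → (c' - c) * R t ≤ (α c' - α c) * t + C) :
    Tendsto (fun t => (1 / t) * R t) atTop (𝓝 A) := by
  have hlim : ∀ C S : ℝ, Tendsto (fun t : ℝ => S + C / t) atTop (𝓝 S) := fun C S => by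
    simpa using (tendsto_const_nhds (x := S)).add (tendsto_const_nhds.div_atTop tendsto_id)
  refine tendsto_order.2 ⟨fun B hB => ?_, fun B hB => ?_⟩
  · have h1 := (hasDerivWithinAt_iff_tendsto_slope' (notMem_Iio.2 le_rfl)).1
      (hα.hasDerivWithinAt (s := Iio c))
    obtain ⟨c', hc', hlt⟩ := ((h1.eventually (lt_mem_nhds hB)).and self_mem_nhdsWithin).exists
    obtain ⟨C, hC⟩ := h c'
    have h0 : c' - c < 0 := sub_neg.2 hlt
    rw [slope_def_field] at hc'
    filter_upwards [(hlim (C / (c' - c)) _).eventually (lt_mem_nhds hc'), eventually_ge_atTop t₀,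
      eventually_gt_atTop 0] with t ht ht₀ htpos
    refine ht.trans_le ?_
    have e : (α c' - α c) / (c' - c) + C / (c' - c) / t =
        (1 / t) * (((α c' - α c) * t + C) / (c' - c)) := by
      field_simp
    rw [e]
    gcongr
    rw [div_le_iff_of_neg h0]
    linarith [hC t ht₀]
  · have h1 := (hasDerivWithinAt_iff_tendsto_slope' (notMem_Ioi.2 le_rfl)).1
      (hα.hasDerivWithinAt (s := Ioi c))
    obtain ⟨c', hc', hlt⟩ := ((h1.eventually (gt_mem_nhds hB)).and self_mem_nhdsWithin).exists
    obtain ⟨C, hC⟩ := h c'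
    have h0 : 0 < c' - c := sub_pos.2 hlt
    rw [slope_def_field] at hc'
    filter_upwards [(hlim (C / (c' - c)) _).eventually (gt_mem_nhds hc'), eventually_ge_atTop t₀,
      eventually_gt_atTop 0] with t ht ht₀ htpos
    refine lt_of_le_of_lt ?_ ht
    have e : (α c' - α c) / (c' - c) + C / (c' - c) / t =
        (1 / t) * (((α c' - α c) * t + C) / (c' - c)) := by
      field_simp
    rw [e]
    gcongr
    rw [le_div_iff₀ h0]
    linarith [hC t ht₀]

theorem exists_subgradient_bound_of_calibrated {H : ℝ → ℝ → ℝ → ℝ} (hH : BurgersHyp H) {α : ℝ → ℝ}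
    (hα : MatherAlpha H α) {c t₀ : ℝ} {u : ℝ → ℝ → ℝ} (hu : IsViscSolOn H c t₀ u) {x g : ℝ → ℝ}
    (hx : ∀ t, t₀ ≤ t → CalibratedCurve H c u x g t₀ t) (c' : ℝ) :
    ∃ C, ∀ t, t₀ ≤ t → (c' - c) * ∫ s in t₀..t, g s ≤ (α c' - α c) * t + C := by
  have hs := hH.shiftMom c'
  have hw : ContDiff ℝ 1 fun _ : ℝ => (0 : ℝ) := contDiff_const
  have hper : ∀ x : ℝ, (fun _ : ℝ => (0 : ℝ)) (x + 1) = (fun _ => 0) x := fun _ => rfl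
  obtain ⟨M, hM⟩ := hα.2.2.2 c t₀ u hu
  obtain ⟨M', hM'⟩ := hα.2.2.2 c' t₀ _
    (isViscSolOn_shiftMom.1 (value_isViscSolOn (a := t₀) hs hw hper))
  refine ⟨M + M' + value (shiftMom H c') (fun _ => 0) t₀ t₀ (x t₀) - u t₀ (x t₀), fun t ht => ?_⟩
  obtain ⟨hac, hint, hcal⟩ := hx t ht
  have e : ∀ s, Lag (shiftMom H c') s (x s) (g s) =
      (Lag H s (x s) (g s) - c * g s) - (c' - c) * g s := fun s => by
    rw [lag_shiftMom hH]; ring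
  have hg := hac.1.const_mul (c' - c)
  have h1 := value_le_add_of_isAC hs hw hper ht hac (by simp only [e]; exact hint.sub hg)
  simp only [e] at h1
  rw [intervalIntegral.integral_sub hint hg, intervalIntegral.integral_const_mul] at h1
  have h2 := (abs_le.1 (hM t ht (x t))).2
  have h3 := (abs_le.1 (hM' t ht (x t))).1
  linarith

/-! ### Approximation by value functions -/

theorem exists_contDiff_periodic_approx {v : ℝ → ℝ} (hv : Continuous v)
    (hper : ∀ x, v (x + 1) = v x) {e : ℝ} (he : 0 < e) :
    ∃ w, ContDiff ℝ 1 w ∧ (∀ x, w (x + 1) = w x) ∧ ∀ x, |w x - v x| ≤ e := by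
  obtain ⟨δ, hδ, hmod⟩ := exists_modulus_on_Icc (u := fun _ => v) (a := 0)
    (by fun_prop) (fun _ => hper) 0 he
  have hi : ∀ p q, IntervalIntegrable v volume p q := fun p q => hv.intervalIntegrable p q
  set d := δ / 2 with hd
  have hd0 : 0 < d := by positivity
  have hderiv : ∀ x, HasDerivAt (fun x => (1 / d) * ∫ s in x..(x + d), v s)
      ((1 / d) * (v (x + d) - v x)) x := by
    intro x
    have h1 := (hv.integral_hasStrictDerivAt 0 (x + d)).hasDerivAt.comp_add_const x d
    have h2 := ((h1.sub (hv.integral_hasStrictDerivAt 0 x).hasDerivAt).const_mul (1 / d))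
    refine h2.congr_of_eventuallyEq (Eventually.of_forall fun y => ?_)
    simp only [Pi.sub_apply]
    rw [intervalIntegral.integral_interval_sub_left (hi _ _) (hi _ _)]
  refine ⟨fun x => (1 / d) * ∫ s in x..(x + d), v s, ?_, fun x => ?_, fun x => ?_⟩
  · refine contDiff_one_iff_deriv.2 ⟨fun x => (hderiv x).differentiableAt, ?_⟩
    rw [show deriv _ = fun x => (1 / d) * (v (x + d) - v x) from funext fun x => (hderiv x).deriv]
    fun_prop
  · simp only
    rw [show x + 1 + d = (x + d) + 1 by ring, ← intervalIntegral.integral_comp_add_right]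
    simp only [hper]
  · have h1 := abs_mul_sub_integral_le hd0.le (hi x (x + d)) (c := v x) (δ := e)
      fun σ hσ => by
        refine (hmod 0 (by simp) 0 (by simp) x σ (by simpa using hδ) ?_).le
        rw [abs_sub_comm, abs_of_nonneg (sub_nonneg.2 hσ.1)]
        linarith [hσ.2]
    have e1 : (1 / d) * (∫ s in x..(x + d), v s) - v x =
        -((d * v x - ∫ s in x..(x + d), v s) / d) := by field_simp; ring
    rw [e1, abs_neg, abs_div, abs_of_pos hd0, div_le_iff₀ hd0]
    linarith

section

variable {H : ℝ → ℝ → ℝ → ℝ} {a : ℝ}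

theorem value_le_value_add (hH : BurgersHyp H) {w w' : ℝ → ℝ} (hw : ContDiff ℝ 1 w)
    (hper : ∀ x, w (x + 1) = w x) (hw' : ContDiff ℝ 1 w') (hper' : ∀ x, w' (x + 1) = w' x) {e : ℝ}
    (h : ∀ x, w x ≤ w' x + e) {t : ℝ} (hat : a ≤ t) (x : ℝ) :
    value H w a t x ≤ value H w' a t x + e := by
  obtain ⟨γ, hγ, rfl⟩ := exists_isMinimizing hH hw' hper' hat x
  have h1 := value_le hH hw hper hat (hγ.orbit.subCurve hH a t a)
  rw [intervalIntegral.integral_same, sub_zero] at h1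
  rw [hγ.value_eq hH]
  linarith [h (γ a).1]

theorem exists_value_approx (hH : BurgersHyp H) {u : ℝ → ℝ → ℝ} (hu : IsViscSolOn H 0 a u) {e : ℝ}
    (he : 0 < e) : ∃ w, ContDiff ℝ 1 w ∧ (∀ x, w (x + 1) = w x) ∧
      ∀ t, a ≤ t → ∀ x, |value H w a t x - u t x| ≤ e := by
  obtain ⟨huc, hup, hsub, hsup⟩ := hu
  have hc : Continuous (u a) := by
    have := huc.continuous_clamp.comp (by fun_prop : Continuous fun x : ℝ => (a, x))
    simpa [Function.comp_def] using this
  obtain ⟨w, hw, hper, hwu⟩ := exists_contDiff_periodic_approx hc (hup a) he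
  refine ⟨w, hw, hper, fun t ht x => ?_⟩
  have hw1 : ContDiff ℝ 1 fun x => w x + e := hw.add contDiff_const
  have hw2 : ContDiff ℝ 1 fun x => w x - e := hw.sub contDiff_const
  have hper1 : ∀ x, w (x + 1) + e = w x + e := fun x => by rw [hper]
  have hper2 : ∀ x, w (x + 1) - e = w x - e := fun x => by rw [hper]
  obtain ⟨c1, p1, -, s1⟩ := value_isViscSolOn (a := a) hH hw1 hper1
  obtain ⟨c2, p2, s2, -⟩ := value_isViscSolOn (a := a) hH hw2 hper2
  have h1 := viscosity_comparison hH huc c1 hup p1 hsub s1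
    (Or.inr (value_lipOnStrips hH hw1 hper1)) (fun x => by
      rw [value_self hH hw1 hper1]
      linarith [(abs_le.1 (hwu x)).1]) t ht x
  have h2 := viscosity_comparison hH c2 huc p2 hup s2 hsup
    (Or.inl (value_lipOnStrips hH hw2 hper2)) (fun x => by
      rw [value_self hH hw2 hper2]
      linarith [(abs_le.1 (hwu x)).2]) t ht x
  have h3 := value_le_value_add hH hw1 hper1 hw hper (e := e) (fun _ => le_rfl) ht x
  have h4 := value_le_value_add hH hw hper hw2 hper2 (e := e) (fun _ => by linarith) ht x
  rw [abs_le]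
  constructor <;> linarith

end

/-! ### Existence of calibrated curves -/

section

variable {H : ℝ → ℝ → ℝ → ℝ} {a : ℝ} {u : ℝ → ℝ → ℝ}

theorem exists_almost_calibrated_orbit (hH : BurgersHyp H) (hu : IsViscSolOn H 0 a u) {e : ℝ}
    (he : 0 < e) {T : ℝ} (hT : a ≤ T) : ∃ γ, IsOrbit H γ ∧ (γ a).1 ∈ Icc (0 : ℝ) 1 ∧
      ∀ s s', a ≤ s → s ≤ s' → s' ≤ T →
        |u s' (γ s').1 - u s (γ s).1 - ∫ σ in s..s', momLag H σ (γ σ).1 (γ σ).2| ≤ e := by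
  obtain ⟨w, hw, hper, hwu⟩ := exists_value_approx hH hu (half_pos he)
  obtain ⟨γ, hγ, -⟩ := exists_isMinimizing hH hw hper hT 0
  set n : ℤ := -⌊(γ a).1⌋ with hn
  refine ⟨_, hγ.orbit.add_const hH n, ?_, fun s s' hs hss hs' => ?_⟩
  · simp only [Prod.fst_add, hn, Int.cast_neg]
    exact ⟨by linarith [Int.floor_le (γ a).1], by linarith [Int.lt_floor_add_one (γ a).1]⟩
  · simp only [Prod.fst_add, Prod.snd_add, add_zero, add_intCast_of_periodic' hu.2.1,
      add_intCast_of_periodic hH.momLag_add_one]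
    have h1 := hγ.value_eq_add hH hw hper hs hss hs'
    have h2 := abs_le.1 (hwu s hs (γ s).1)
    have h3 := abs_le.1 (hwu s' (hs.trans hss) (γ s').1)
    rw [abs_le]
    constructor <;> linarith [h2.1, h2.2, h3.1, h3.2]

theorem exists_momentum_bound_of_almost_calibrated (hH : BurgersHyp H)
    (hu : IsViscSolOn H 0 a u) : ∃ K, ∀ γ, IsOrbit H γ →
      |u (a + 1) (γ (a + 1)).1 - u a (γ a).1 - ∫ σ in a..(a + 1), momLag H σ (γ σ).1 (γ σ).2| ≤ 1 →
        |(γ a).2| ≤ K := by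
  obtain ⟨M, hM⟩ := exists_bound_on_Icc hu.1 hu.2.1 (a + 1)
  obtain ⟨N, hN⟩ := hH.exists_le_lag a (a + 1) 1
  obtain ⟨K, hK⟩ := hH.exists_mom_bound a (a + 1) (2 * M + 2 + N)
  obtain ⟨K', hK'⟩ := hH.exists_orbit_bound a (a + 1) K
  have ha : a ≤ a + 1 := by linarith
  refine ⟨K', fun γ hγ h => ?_⟩
  suffices ∃ s ∈ Icc a (a + 1), |pDeriv H s (γ s).1 (γ s).2| ≤ 2 * M + 2 + N by
    obtain ⟨s, hs, hsv⟩ := this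
    refine hK' γ hγ s hs ?_ a (left_mem_Icc.2 ha)
    rw [← hH.mom_pDeriv s (γ s).1 (γ s).2]
    exact hK s hs _ _ hsv
  by_contra! hcon
  have h1 : ∫ σ in a..(a + 1), (2 * M + 2) ≤ ∫ σ in a..(a + 1), momLag H σ (γ σ).1 (γ σ).2 := by
    refine intervalIntegral.integral_mono_on ha (by simp)
      ((hγ.continuous_momLag hH).intervalIntegrable _ _) fun s hs => ?_
    rw [← hH.lag_pDeriv]
    linarith [hN s hs (γ s).1 (pDeriv H s (γ s).1 (γ s).2), hcon s hs]
  rw [intervalIntegral.integral_const, add_sub_cancel_left, one_smul] at h1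
  linarith [(abs_le.1 (hM _ (right_mem_Icc.2 ha) (γ (a + 1)).1)).2, (abs_le.1 h).1,
    (abs_le.1 (hM _ (left_mem_Icc.2 ha) (γ a).1)).1]

theorem IsOrbit.tendsto_integral_momLag (hH : BurgersHyp H) {γ : ℝ → ℝ × ℝ} (hγ : IsOrbit H γ)
    {η : ℕ → ℝ → ℝ × ℝ} (hη : ∀ n, IsOrbit H (η n)) {s s' : ℝ} (hss : s ≤ s')
    (h : TendstoUniformlyOn η γ atTop (Icc s s')) :
    Tendsto (fun n => ∫ σ in s..s', momLag H σ (η n σ).1 (η n σ).2) atTop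
      (𝓝 (∫ σ in s..s', momLag H σ (γ σ).1 (γ σ).2)) := by
  obtain ⟨R, -, hR⟩ := hγ.exists_bound s s'
  obtain ⟨M, hM⟩ := exists_bound_on_strip (F := momLag H)
    (hH.continuous_momLag (by fun_prop) (by fun_prop) (by fun_prop)) hH.momLag_add_one s s' (R + 1)
  refine intervalIntegral.tendsto_integral_filter_of_dominated_convergence (fun _ => M)
    (Eventually.of_forall fun n => ((hη n).continuous_momLag hH).aestronglyMeasurable) ?_
    (by simp) (Eventually.of_forall fun σ hσ => ?_)
  · filter_upwards [Metric.tendstoUniformlyOn_iff.1 h 1 one_pos] with n hn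
    refine Eventually.of_forall fun σ hσ => ?_
    rw [uIoc_of_le hss] at hσ
    have hσ' := Ioc_subset_Icc_self hσ
    refine hM σ hσ' _ _ ?_
    have h1 : dist (γ σ).2 (η n σ).2 < 1 := (le_max_right _ _).trans_lt (hn σ hσ')
    rw [Real.dist_eq, abs_sub_comm] at h1
    linarith [abs_sub_abs_le_abs_sub (η n σ).2 (γ σ).2, hR σ hσ']
  · rw [uIoc_of_le hss] at hσ
    have h1 := h.tendsto_at (Ioc_subset_Icc_self hσ)
    have h2 : Continuous fun z : ℝ × ℝ => momLag H σ z.1 z.2 :=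
      hH.continuous_momLag (by fun_prop) (by fun_prop) (by fun_prop)
    exact (h2.tendsto _).comp h1

theorem exists_calibrated_orbit (hH : BurgersHyp H) (hu : IsViscSolOn H 0 a u) :
    ∃ γ, IsOrbit H γ ∧ ∀ s s', a ≤ s → s ≤ s' →
      u s' (γ s').1 = u s (γ s).1 + ∫ σ in s..s', momLag H σ (γ σ).1 (γ σ).2 := by
  obtain ⟨K, hK⟩ := exists_momentum_bound_of_almost_calibrated hH hu
  choose η hη hη0 hηu using fun n : ℕ => exists_almost_calibrated_orbit hH hu
    (e := 1 / ((n : ℝ) + 1)) (by positivity) (T := a + n + 1) (by linarith [n.cast_nonneg (α := ℝ)])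
  have hmem : ∀ n, η n a ∈ Icc (0 : ℝ) 1 ×ˢ Icc (-K) K := fun n => by
    refine ⟨hη0 n, abs_le.1 (hK _ (hη n) ((hηu n a (a + 1) le_rfl (by linarith) ?_).trans ?_))⟩
    · linarith [n.cast_nonneg (α := ℝ)]
    · rw [div_le_one (by positivity)]
      linarith [n.cast_nonneg (α := ℝ)]
  obtain ⟨z, -, φ, hφ, hz⟩ := (isCompact_Icc.prod isCompact_Icc).tendsto_subseq hmem
  obtain ⟨γ, hγ, rfl⟩ := hH.exists_orbit a z
  refine ⟨γ, hγ, fun s s' hs hss => ?_⟩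
  have hunif := hγ.tendstoUniformlyOn hH (fun n => hη (φ n)) (b := s')
    (left_mem_Icc.2 (hs.trans hss)) hz
  have hlim : ∀ t ∈ Icc a s', Tendsto (fun n => u t (η (φ n) t).1) atTop (𝓝 (u t (γ t).1)) := by
    intro t ht
    have hc : Continuous fun x : ℝ => u t x := by
      refine (hu.1.comp_continuous (f := fun x : ℝ => (t, x)) (by fun_prop) fun x => ?_)
      exact ⟨ht.1, trivial⟩
    exact (hc.tendsto _).comp ((continuous_fst.tendsto _).comp (hunif.tendsto_at ht))
  have hint := hγ.tendsto_integral_momLag hH (fun n => hη (φ n)) hss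
    (hunif.mono (Icc_subset_Icc_left hs))
  have h1 := ((((hlim s' ⟨hs.trans hss, le_rfl⟩).sub (hlim s ⟨hs, hss⟩)).sub hint)).abs
  have h2 : Tendsto (fun n => 1 / ((φ n : ℝ) + 1)) atTop (𝓝 0) :=
    tendsto_one_div_add_atTop_nhds_zero_nat.comp hφ.tendsto_atTop
  have h3 := le_of_tendsto_of_tendsto h1 h2 (by
    filter_upwards [eventually_ge_atTop ⌈s' - a⌉₊] with n hn
    have h4 : (s' - a : ℝ) ≤ φ n := (Nat.ceil_le.1 (hn.trans (hφ.id_le n)))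
    exact hηu (φ n) s s' hs hss (by linarith))
  linarith [abs_nonpos_iff.1 h3]

theorem exists_calibratedCurve (hH : BurgersHyp H) {c : ℝ} (hu : IsViscSolOn H c a u) :
    ∃ x g : ℝ → ℝ, ∀ t t', a ≤ t → t ≤ t' → CalibratedCurve H c u x g t t' := by
  have hs := hH.shiftMom c
  obtain ⟨γ, hγ, hcal⟩ := exists_calibrated_orbit hs (isViscSolOn_shiftMom.2 hu)
  have hg : Continuous fun s => pDeriv (shiftMom H c) s (γ s).1 (γ s).2 :=
    hs.continuous_pDeriv continuous_id hγ.continuous_fst hγ.continuous_snd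
  have e : ∀ s, Lag H s (γ s).1 (pDeriv (shiftMom H c) s (γ s).1 (γ s).2) -
      c * pDeriv (shiftMom H c) s (γ s).1 (γ s).2 = momLag (shiftMom H c) s (γ s).1 (γ s).2 :=
    fun s => by rw [← lag_shiftMom hH, hs.lag_pDeriv]
  refine ⟨fun s => (γ s).1, fun s => pDeriv (shiftMom H c) s (γ s).1 (γ s).2,
    fun t t' ht htt => ⟨⟨hg.intervalIntegrable _ _, fun s _ => ?_⟩, ?_, ?_⟩⟩
  · rw [intervalIntegral.integral_eq_sub_of_hasDerivAt (fun r _ => hγ.hasDerivAt_fst r)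
      (hg.intervalIntegrable _ _)]
    ring
  · simp only [e]
    exact (hγ.continuous_momLag hs).intervalIntegrable _ _
  · simp only [e]
    exact hcal t t' ht htt

end

/-- for a viscosity solution `u` of `(HJc)` on `[t₀,∞) × 𝕋` there exist
curves calibrated by `u` on `[t₀,∞)`, and every such curve has rotation number
`lim (1/t) ∫_{t₀}^t ẋ = α'(c)`. -/
theorem stmt_10 (H : ℝ → ℝ → ℝ → ℝ) (hH : BurgersHyp H) (α : ℝ → ℝ)
    (hα : MatherAlpha H α) (c t₀ : ℝ) (u : ℝ → ℝ → ℝ) (hu : IsViscSolOn H c t₀ u) :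
    (∃ x g : ℝ → ℝ, ∀ t t' : ℝ, t₀ ≤ t → t ≤ t' → CalibratedCurve H c u x g t t') ∧
    (∀ x g : ℝ → ℝ, (∀ t t' : ℝ, t₀ ≤ t → t ≤ t' → CalibratedCurve H c u x g t t') →
      Tendsto (fun t => (1 / t) * ∫ s in t₀..t, g s) atTop (𝓝 (deriv α c))) := by
  exact ⟨exists_calibratedCurve hH hu, fun x g h =>
    tendsto_div_of_forall_subgradient_bound ((hα.1.differentiable (by norm_num)) c).hasDerivAt
      (exists_subgradient_bound_of_calibrated hH hα hu fun t ht => h t₀ t le_rfl ht)⟩
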